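/- arXiv:1303.2967 — 3 statements merged into one kernel-verified Lean document; each statement's English description precedes it below -/
import Mathlib

section
/- Let Σ be a finite alphabet, let φ : Σ* → O(n) be a monoid morphism into the group of n×n real orthogonal matrices, and let L ⊆ Σ* be a context-free language (i.e. L is generated by some context-free grammar with terminal alphabet Σ). Then the topological closure of φ(L) in the space of n×n real matrices is semialgebraic. -/
open Matrix

/-- A subset of `ℝ^σ` is semialgebraic if it is a finite union of sets of the form
`{x : p(x) = 0 ∧ q₁(x) > 0 ∧ … ∧ q_m(x) > 0}` for real polynomials `p, q₁, …, q_m`. -/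
def IsSemialgebraic {σ : Type} [Fintype σ] (A : Set (σ → ℝ)) : Prop :=
  ∃ (k : ℕ) (p : Fin k → MvPolynomial σ ℝ) (q : Fin k → Finset (MvPolynomial σ ℝ)),
    A = ⋃ i, {x | MvPolynomial.eval x (p i) = 0 ∧ ∀ r ∈ q i, 0 < MvPolynomial.eval x r}

/-- A set of matrices is semialgebraic if the corresponding set of entry-vectors is. -/
def MatSemialgebraic {ι : Type} [Fintype ι] (A : Set (Matrix ι ι ℝ)) : Prop :=
  IsSemialgebraic {x : ι × ι → ℝ | (Matrix.of fun i j => x (i, j)) ∈ A}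

section SignCells

open Polynomial

/-- Every strictly monotone map on a finite set of reals extends to an order automorphism. -/
lemma exists_orderIso_eqOn (Y : Finset ℝ) (e : ℝ → ℝ) (he : StrictMonoOn e Y) :
    ∃ g : ℝ ≃o ℝ, ∀ y ∈ Y, g y = e y := by
  induction Y using Finset.induction_on_max with
  | empty => exact ⟨OrderIso.refl ℝ, by simp⟩
  | insert y Y hy ih =>
    obtain ⟨g₀, hg₀⟩ := ih (he.mono (by simp))
    rcases Y.eq_empty_or_nonempty with rfl | hne
    · exact ⟨OrderIso.addRight (e y - y), by simp⟩
    · set c := Y.max' hne with hc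
      have hcY : c ∈ Y := Y.max'_mem hne
      have hcy : c < y := hy c hcY
      have hecy : g₀ c < e y := by
        rw [hg₀ c hcY]
        exact he (by simp [hcY]) (by simp) hcy
      set m := (e y - g₀ c) / (y - c) with hm
      have hm0 : 0 < m := div_pos (by linarith) (by linarith)
      let f : ℝ → ℝ := fun t => if t ≤ c then g₀ t else g₀ c + (t - c) * m
      have hf : StrictMono f := by
        intro s t hst
        simp only [f]
        split_ifs with h1 h2 h2
        · exact g₀.strictMono hst
        · have := g₀.monotone h1
          have := mul_pos (sub_pos.2 (not_le.1 h2)) hm0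
          linarith
        · linarith
        · have := mul_lt_mul_of_pos_right hst hm0
          linarith
      have hfs : Function.Surjective f := by
        intro v
        by_cases hv : v ≤ g₀ c
        · refine ⟨g₀.symm v, ?_⟩
          have : g₀.symm v ≤ c := by rwa [OrderIso.symm_apply_le]
          simp [f, this]
        · have h3 : 0 < (v - g₀ c) / m := div_pos (by linarith) hm0
          refine ⟨c + (v - g₀ c) / m, ?_⟩
          have : ¬ (c + (v - g₀ c) / m ≤ c) := by linarith
          simp only [f, this, if_false]
          field_simp
          ring
      refine ⟨hf.orderIsoOfSurjective f hfs, ?_⟩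
      intro x hx
      rw [StrictMono.coe_orderIsoOfSurjective]
      rcases Finset.mem_insert.1 hx with rfl | hx
      · have : ¬ (x ≤ c) := not_le.2 hcy
        have h4 : x - c ≠ 0 := by linarith
        simp only [f, this, if_false, hm]
        field_simp
        ring
      · have : x ≤ c := Y.le_max' x hx
        simp [f, this, hg₀ x hx]

/-- The connected component of `t` in the complement of the finite set `Z` (when `t ∉ Z`). -/
def signCell (Z : Finset ℝ) (t : ℝ) : Set ℝ :=
  {s | ∀ z ∈ Z, (z < t → z < s) ∧ (t < z → s < z)}

lemma mem_signCell_self (Z : Finset ℝ) (t : ℝ) : t ∈ signCell Z t := fun _ _ => ⟨id, id⟩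

lemma isOpen_signCell (Z : Finset ℝ) (t : ℝ) : IsOpen (signCell Z t) := by
  have : signCell Z t = ⋂ z ∈ Z, {s | (z < t → z < s) ∧ (t < z → s < z)} := by
    ext s; simp [signCell]
  rw [this]
  refine isOpen_biInter_finset fun z _ => IsOpen.inter ?_ ?_
  · by_cases h : z < t
    · simp only [h, forall_const]
      exact isOpen_Ioi
    · simp only [h, false_imp_iff]
      exact isOpen_univ
  · by_cases h : t < z
    · simp only [h, forall_const]
      exact isOpen_Iio
    · simp only [h, false_imp_iff]
      exact isOpen_univ

lemma ordConnected_signCell (Z : Finset ℝ) (t : ℝ) : (signCell Z t).OrdConnected :=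
  ⟨fun _ hx _ hy _ hs z hz =>
    ⟨fun h => ((hx z hz).1 h).trans_le hs.1, fun h => hs.2.trans_lt ((hy z hz).2 h)⟩⟩

lemma notMem_of_mem_signCell {Z : Finset ℝ} {s t : ℝ} (ht : t ∉ Z) (hs : s ∈ signCell Z t) :
    s ∉ Z := by
  intro hsZ
  rcases lt_trichotomy s t with h | rfl | h
  · exact lt_irrefl _ ((hs s hsZ).1 h)
  · exact ht hsZ
  · exact lt_irrefl _ ((hs s hsZ).2 h)

lemma signCell_image (Z : Finset ℝ) (h : ℝ ≃o ℝ) (s t : ℝ) :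
    h s ∈ signCell (Z.image h) (h t) ↔ s ∈ signCell Z t := by
  simp [signCell]

lemma signCell_image_congr {Z : Finset ℝ} {g h : ℝ ≃o ℝ} (hgh : ∀ z ∈ Z, g z = h z)
    (s t : ℝ) : g s ∈ signCell (Z.image h) (h t) ↔ s ∈ signCell Z t := by
  simp only [signCell, Set.mem_ofPred_eq, Finset.forall_mem_image]
  refine forall₂_congr fun z hz => ?_
  rw [h.lt_iff_lt, h.lt_iff_lt, ← hgh z hz, g.lt_iff_lt, g.lt_iff_lt]

lemma polynomial_eval_ne_zero_sign_eq {p : ℝ[X]} {I : Set ℝ} (hI : I.OrdConnected)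
    (hp : ∀ x ∈ I, p.eval x ≠ 0) {x y : ℝ} (hx : x ∈ I) (hy : y ∈ I) :
    SignType.sign (p.eval x) = SignType.sign (p.eval y) := by
  by_contra hne
  have hpre := hI.isPreconnected.image _ p.continuous.continuousOn
  have h0 : (0 : ℝ) ∈ (fun x => p.eval x) '' I := by
    have hoc := hpre.ordConnected
    rcases lt_or_gt_of_ne (hp x hx) with h1 | h1 <;> rcases lt_or_gt_of_ne (hp y hy) with h2 | h2
    · simp [sign_neg h1, sign_neg h2] at hne
    · exact hoc.out ⟨x, hx, rfl⟩ ⟨y, hy, rfl⟩ ⟨h1.le, h2.le⟩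
    · exact hoc.out ⟨y, hy, rfl⟩ ⟨x, hx, rfl⟩ ⟨h2.le, h1.le⟩
    · simp [sign_pos h1, sign_pos h2] at hne
  obtain ⟨z, hz, hz0⟩ := h0
  exact hp z hz hz0

lemma polynomial_strictMonoOn_of_deriv_pos {p : ℝ[X]} {D : Set ℝ} (hD : Convex ℝ D)
    (hp : ∀ x ∈ interior D, 0 < p.derivative.eval x) : StrictMonoOn (fun x => p.eval x) D :=
  strictMonoOn_of_deriv_pos hD p.continuous.continuousOn (by simpa using hp)

/-- Two polynomials whose derivatives have matching signs along `h` and whose signs match on a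
finite set containing the roots of the derivative. -/
structure SignStep (Z : Finset ℝ) (h : ℝ ≃o ℝ) (a b : ℝ[X]) : Prop where
  sign_eq : ∀ z ∈ Z, SignType.sign (a.eval z) = SignType.sign (b.eval (h z))
  deriv_ne : ∀ t ∉ Z, a.derivative.eval t ≠ 0
  deriv_sign : ∀ t, SignType.sign (a.derivative.eval t) =
    SignType.sign (b.derivative.eval (h t))

namespace SignStep

variable {Z : Finset ℝ} {h : ℝ ≃o ℝ} {a b : ℝ[X]}

lemma symm (H : SignStep Z h a b) : SignStep (Z.image h) h.symm b a where
  sign_eq := by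
    simp only [Finset.forall_mem_image, OrderIso.symm_apply_apply]
    exact fun z hz => (H.sign_eq z hz).symm
  deriv_ne := by
    intro t ht h0
    have h1 : h.symm t ∉ Z := fun hz => ht (Finset.mem_image.2 ⟨_, hz, by simp⟩)
    have h2 := H.deriv_sign (h.symm t)
    rw [OrderIso.apply_symm_apply, h0, sign_zero, sign_eq_zero_iff] at h2
    exact H.deriv_ne _ h1 h2
  deriv_sign := by
    intro t
    have h2 := H.deriv_sign (h.symm t)
    rw [OrderIso.apply_symm_apply] at h2
    exact h2.symm

lemma neg (H : SignStep Z h a b) : SignStep Z h (-a) (-b) where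
  sign_eq := by
    intro z hz
    simp [Left.sign_neg, H.sign_eq z hz]
  deriv_ne := by
    intro t ht
    simpa using H.deriv_ne t ht
  deriv_sign := by
    intro t
    simp [Left.sign_neg, H.deriv_sign t]

lemma deriv_pos_of_mem (H : SignStep Z h a b) {s t : ℝ} (ht : t ∉ Z)
    (hpos : 0 < a.derivative.eval t) (hs : s ∈ signCell Z t) : 0 < a.derivative.eval s := by
  have := polynomial_eval_ne_zero_sign_eq (ordConnected_signCell Z t)
    (fun x hx => H.deriv_ne x (notMem_of_mem_signCell ht hx)) (mem_signCell_self Z t) hs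
  rw [sign_pos hpos] at this
  exact sign_eq_one_iff.1 this.symm

lemma image_notMem {t : ℝ} (ht : t ∉ Z) : h t ∉ Z.image h := by
  simpa using ht

lemma deriv_pos_right (H : SignStep Z h a b) {t : ℝ} (hpos : 0 < a.derivative.eval t) :
    0 < b.derivative.eval (h t) := by
  have := H.deriv_sign t
  rw [sign_pos hpos] at this
  exact sign_eq_one_iff.1 this.symm

lemma exists_neg (H : SignStep Z h a b) {s t : ℝ} (ht : t ∉ Z)
    (hpos : 0 < a.derivative.eval t) (hs : s ∈ signCell Z t) (hneg : a.eval s < 0) :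
    ∃ s' ∈ signCell (Z.image h) (h t), b.eval s' < 0 := by
  have hposb := H.deriv_pos_right hpos
  rcases (Z.filter (· < t)).eq_empty_or_nonempty with he | hne
  · by_contra! hcon
    have hmem : ∀ x ≤ h t, x ∈ signCell (Z.image h) (h t) := by
      intro x hx z hz
      obtain ⟨w, hw, rfl⟩ := Finset.mem_image.1 hz
      refine ⟨fun hlt => ?_, fun hlt => hx.trans_lt hlt⟩
      have : w ∈ Z.filter (· < t) := by simpa [hw] using hlt
      simp [he] at this
    have hmono : StrictMonoOn (fun x => b.eval x) (Set.Iic (h t)) := by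
      refine polynomial_strictMonoOn_of_deriv_pos (convex_Iic _) fun x hx => ?_
      rw [interior_Iic] at hx
      exact H.symm.deriv_pos_of_mem (image_notMem ht) hposb (hmem x (le_of_lt hx))
    have hdeg : 0 < (b.comp (-X)).degree := by
      rw [← natDegree_pos_iff_degree_pos, natDegree_comp]
      simp only [natDegree_neg, natDegree_X, mul_one]
      by_contra h0
      rw [eq_C_of_natDegree_eq_zero (by omega : b.natDegree = 0)] at hposb
      simp at hposb
    have hlim := (b.comp (-X)).abs_tendsto_atTop hdeg
    obtain ⟨x, hx1, hx2⟩ := ((hlim.eventually_gt_atTop (b.eval (h t))).and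
      (Filter.eventually_ge_atTop (-(h t)))).exists
    simp only [eval_comp, eval_neg, eval_X] at hx1
    have hx3 : -x ≤ h t := by linarith
    rw [abs_of_nonneg (hcon _ (hmem _ hx3))] at hx1
    exact absurd (hmono.monotoneOn hx3 (Set.mem_Iic.2 le_rfl) hx3) (not_le.2 hx1)
  · set z := (Z.filter (· < t)).max' hne with hz
    have hzm : z ∈ Z.filter (· < t) := Finset.max'_mem _ hne
    obtain ⟨hzZ, hzt⟩ := Finset.mem_filter.1 hzm
    have hcell : ∀ x, z < x → x ≤ t → x ∈ signCell Z t := by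
      intro x h1 h2 w hw
      refine ⟨fun hlt => ?_, fun hlt => h2.trans_lt hlt⟩
      exact (Finset.le_max' _ w (by simp [hw, hlt])).trans_lt h1
    have hzs : z < s := (hs z hzZ).1 hzt
    have hmono : StrictMonoOn (fun x => a.eval x) (Set.Icc z s) := by
      refine polynomial_strictMonoOn_of_deriv_pos (convex_Icc _ _) fun x hx => ?_
      rw [interior_Icc] at hx
      refine H.deriv_pos_of_mem ht hpos ?_
      rcases le_total x t with hxt | hxt
      · exact hcell x hx.1 hxt
      · exact (ordConnected_signCell Z t).out (mem_signCell_self Z t) hs ⟨hxt, hx.2.le⟩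
    have haz : a.eval z < 0 :=
      (hmono ⟨le_rfl, hzs.le⟩ ⟨hzs.le, le_rfl⟩ hzs).trans hneg
    have hbz : b.eval (h z) < 0 := by
      have := H.sign_eq z hzZ
      rw [sign_neg haz] at this
      exact sign_eq_neg_one_iff.1 this.symm
    have hev : ∀ᶠ x in nhdsWithin (h z) (Set.Ioi (h z)), b.eval x < 0 :=
      nhdsWithin_le_nhds (b.continuous.continuousAt.eventually_lt_const hbz)
    have hev2 : ∀ᶠ x in nhdsWithin (h z) (Set.Ioi (h z)), x ∈ Set.Ioo (h z) (h t) :=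
      Ioo_mem_nhdsGT (h.strictMono hzt)
    obtain ⟨x, hx1, hx2⟩ := (hev.and hev2).exists
    refine ⟨x, ?_, hx1⟩
    have := (signCell_image Z h (h.symm x) t).2 (hcell _ (by
      rw [OrderIso.lt_symm_apply]; exact hx2.1) (by
      rw [OrderIso.symm_apply_le]; exact hx2.2.le))
    simpa using this

lemma exists_pos (H : SignStep Z h a b) {s t : ℝ} (ht : t ∉ Z)
    (hpos : 0 < a.derivative.eval t) (hs : s ∈ signCell Z t) (hsp : 0 < a.eval s) :
    ∃ s' ∈ signCell (Z.image h) (h t), 0 < b.eval s' := by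
  have hposb := H.deriv_pos_right hpos
  rcases (Z.filter (t < ·)).eq_empty_or_nonempty with he | hne
  · by_contra! hcon
    have hmem : ∀ x, h t ≤ x → x ∈ signCell (Z.image h) (h t) := by
      intro x hx z hz
      obtain ⟨w, hw, rfl⟩ := Finset.mem_image.1 hz
      refine ⟨fun hlt => hlt.trans_le hx, fun hlt => ?_⟩
      have : w ∈ Z.filter (t < ·) := by simpa [hw] using hlt
      simp [he] at this
    have hmono : StrictMonoOn (fun x => b.eval x) (Set.Ici (h t)) := by
      refine polynomial_strictMonoOn_of_deriv_pos (convex_Ici _) fun x hx => ?_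
      rw [interior_Ici] at hx
      exact H.symm.deriv_pos_of_mem (image_notMem ht) hposb (hmem x (le_of_lt hx))
    have hdeg : 0 < b.degree := by
      rw [← natDegree_pos_iff_degree_pos]
      by_contra h0
      rw [eq_C_of_natDegree_eq_zero (by omega : b.natDegree = 0)] at hposb
      simp at hposb
    obtain ⟨x, hx1, hx3⟩ := (((b.abs_tendsto_atTop hdeg).eventually_gt_atTop (-b.eval (h t))).and
      (Filter.eventually_ge_atTop (h t))).exists
    rw [abs_of_nonpos (hcon _ (hmem _ hx3))] at hx1
    exact absurd (hmono.monotoneOn (Set.mem_Ici.2 le_rfl) hx3 hx3)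
      (not_le.2 (neg_lt_neg_iff.1 hx1))
  · set z := (Z.filter (t < ·)).min' hne with hz
    have hzm : z ∈ Z.filter (t < ·) := Finset.min'_mem _ hne
    obtain ⟨hzZ, hzt⟩ := Finset.mem_filter.1 hzm
    have hcell : ∀ x, x < z → t ≤ x → x ∈ signCell Z t := by
      intro x h1 h2 w hw
      refine ⟨fun hlt => hlt.trans_le h2, fun hlt => ?_⟩
      exact h1.trans_le (Finset.min'_le _ w (by simp [hw, hlt]))
    have hzs : s < z := (hs z hzZ).2 hzt
    have hmono : StrictMonoOn (fun x => a.eval x) (Set.Icc s z) := by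
      refine polynomial_strictMonoOn_of_deriv_pos (convex_Icc _ _) fun x hx => ?_
      rw [interior_Icc] at hx
      refine H.deriv_pos_of_mem ht hpos ?_
      rcases le_total t x with hxt | hxt
      · exact hcell x hx.2 hxt
      · exact (ordConnected_signCell Z t).out hs (mem_signCell_self Z t) ⟨hx.1.le, hxt⟩
    have haz : 0 < a.eval z :=
      hsp.trans (hmono ⟨le_rfl, hzs.le⟩ ⟨hzs.le, le_rfl⟩ hzs)
    have hbz : 0 < b.eval (h z) := by
      have := H.sign_eq z hzZ
      rw [sign_pos haz] at this
      exact sign_eq_one_iff.1 this.symm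
    have hev : ∀ᶠ x in nhdsWithin (h z) (Set.Iio (h z)), 0 < b.eval x :=
      nhdsWithin_le_nhds (b.continuous.continuousAt.eventually_const_lt hbz)
    have hev2 : ∀ᶠ x in nhdsWithin (h z) (Set.Iio (h z)), x ∈ Set.Ioo (h t) (h z) :=
      Ioo_mem_nhdsLT (h.strictMono hzt)
    obtain ⟨x, hx1, hx2⟩ := (hev.and hev2).exists
    refine ⟨x, ?_, hx1⟩
    have := (signCell_image Z h (h.symm x) t).2 (hcell _ (by
      rw [OrderIso.symm_apply_lt]; exact hx2.2) (by
      rw [OrderIso.le_symm_apply]; exact hx2.1.le))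
    simpa using this

/-- Every sign attained by `a` on a cell is attained by `b` on the corresponding cell. -/
lemma exists_pos' (H : SignStep Z h a b) {s t : ℝ} (ht : t ∉ Z)
    (hs : s ∈ signCell Z t) (hsp : 0 < a.eval s) :
    ∃ s' ∈ signCell (Z.image h) (h t), 0 < b.eval s' := by
  rcases lt_or_gt_of_ne (H.deriv_ne t ht) with h1 | h1
  · have := H.neg.exists_neg ht (by simpa using h1) hs (by simpa using hsp)
    simpa using this
  · exact H.exists_pos ht h1 hs hsp

lemma exists_neg' (H : SignStep Z h a b) {s t : ℝ} (ht : t ∉ Z)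
    (hs : s ∈ signCell Z t) (hsn : a.eval s < 0) :
    ∃ s' ∈ signCell (Z.image h) (h t), b.eval s' < 0 := by
  have := H.neg.exists_pos' ht hs (by simpa using hsn)
  simpa using this

lemma sign_sub (H : SignStep Z h a b) {s s' t : ℝ} (ht : t ∉ Z) (hs : s ∈ signCell Z t)
    (hs' : s' ∈ signCell Z t) : SignType.sign (a.eval s - a.eval s') =
      SignType.sign (a.derivative.eval t) * SignType.sign (s - s') := by
  wlog hpos : 0 < a.derivative.eval t generalizing a b
  · have h1 : a.derivative.eval t < 0 := lt_of_le_of_ne (not_lt.1 hpos) (H.deriv_ne t ht)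
    have := this H.neg (by simpa using h1)
    simp only [eval_neg, derivative_neg, Left.sign_neg, neg_mul] at this
    rw [← neg_inj, ← this, ← Left.sign_neg]
    congr 1
    ring
  have hmono : StrictMonoOn (fun x => a.eval x) (signCell Z t) := by
    refine polynomial_strictMonoOn_of_deriv_pos (ordConnected_signCell Z t).convex fun x hx => ?_
    exact H.deriv_pos_of_mem ht hpos (interior_subset hx)
  rw [sign_pos hpos, one_mul]
  rcases lt_trichotomy s s' with h1 | rfl | h1
  · rw [sign_neg (sub_neg.2 h1), sign_neg (sub_neg.2 (hmono hs hs' h1))]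
  · simp
  · rw [sign_pos (sub_pos.2 h1), sign_pos (sub_pos.2 (hmono hs' hs h1))]

lemma exists_root (H : SignStep Z h a b) {s t : ℝ} (ht : t ∉ Z)
    (hs : s ∈ signCell Z t) (hsr : a.eval s = 0) :
    ∃ s' ∈ signCell (Z.image h) (h t), b.eval s' = 0 := by
  obtain ⟨l, u, hlu, hsub⟩ := mem_nhds_iff_exists_Ioo_subset.1 ((isOpen_signCell Z t).mem_nhds hs)
  have hx : (l + s) / 2 ∈ signCell Z t := hsub ⟨by linarith [hlu.1], by linarith [hlu.1, hlu.2]⟩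
  have hy : (s + u) / 2 ∈ signCell Z t := hsub ⟨by linarith [hlu.1, hlu.2], by linarith [hlu.2]⟩
  have h1 := H.sign_sub ht hx hs
  have h2 := H.sign_sub ht hy hs
  rw [hsr, sub_zero, sign_neg (by linarith [hlu.1] : (l + s) / 2 - s < 0)] at h1
  rw [hsr, sub_zero, sign_pos (by linarith [hlu.2] : 0 < (s + u) / 2 - s)] at h2
  have key : (∃ x ∈ signCell Z t, 0 < a.eval x) ∧ ∃ x ∈ signCell Z t, a.eval x < 0 := by
    rcases lt_or_gt_of_ne (H.deriv_ne t ht) with h3 | h3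
    · rw [sign_neg h3] at h1 h2
      exact ⟨⟨_, hx, sign_eq_one_iff.1 h1⟩, ⟨_, hy, sign_eq_neg_one_iff.1 h2⟩⟩
    · rw [sign_pos h3] at h1 h2
      exact ⟨⟨_, hy, sign_eq_one_iff.1 h2⟩, ⟨_, hx, sign_eq_neg_one_iff.1 h1⟩⟩
  obtain ⟨⟨x, hx, hxp⟩, ⟨y, hy, hyn⟩⟩ := key
  obtain ⟨x', hx', hxp'⟩ := H.exists_pos' ht hx hxp
  obtain ⟨y', hy', hyn'⟩ := H.exists_neg' ht hy hyn
  by_contra! hcon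
  have := polynomial_eval_ne_zero_sign_eq (ordConnected_signCell _ _) hcon hx' hy'
  rw [sign_pos hxp', sign_neg hyn'] at this
  exact absurd this (by decide)

lemma exists_root_left (H : SignStep Z h a b) {s t : ℝ} (ht : t ∉ Z)
    (hs : s ∈ signCell (Z.image h) (h t)) (hsr : b.eval s = 0) :
    ∃ s' ∈ signCell Z t, a.eval s' = 0 := by
  obtain ⟨s', hs', h0⟩ := H.symm.exists_root (image_notMem ht) hs hsr
  refine ⟨s', ?_, h0⟩
  simpa [Finset.image_image, Function.comp_def] using hs'

end SignStep

/-- The order automorphism can be modified off `Z` so that the signs of `a` and `b` match. -/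
lemma SignStep.exists_orderIso {Z : Finset ℝ} {h : ℝ ≃o ℝ} {a b : ℝ[X]} (H : SignStep Z h a b) :
    ∃ g : ℝ ≃o ℝ, (∀ z ∈ Z, g z = h z) ∧
      ∀ t, SignType.sign (a.eval t) = SignType.sign (b.eval (g t)) := by
  classical
  have hroot : ∀ r, r ∉ Z → a.eval r = 0 →
      ∃ r' ∈ signCell (Z.image h) (h r), b.eval r' = 0 := fun r hr h0 =>
    H.exists_root hr (mem_signCell_self Z r) h0
  choose! ρ hρ hρ0 using hroot
  let e : ℝ → ℝ := fun y => if y ∈ Z then h y else ρ y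
  have hcell : ∀ r, r ∉ Z → a.eval r = 0 → ∀ z ∈ Z, (z < r → h z < ρ r) ∧ (r < z → ρ r < h z) := by
    intro r hr h0 z hz
    have := hρ r hr h0 (h z) (Finset.mem_image_of_mem _ hz)
    simpa using this
  have he : StrictMonoOn e (Z ∪ a.roots.toFinset : Finset ℝ) := by
    intro x hx y hy hxy
    have hroot : ∀ w ∈ Z ∪ a.roots.toFinset, w ∉ Z → a.eval w = 0 := by
      intro w hw hwZ
      simp only [Finset.mem_union, hwZ, false_or, Multiset.mem_toFinset] at hw
      exact isRoot_of_mem_roots hw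
    have hx0 := hroot x hx
    have hy0 := hroot y hy
    simp only [e]
    split_ifs with h1 h2 h2
    · exact h.strictMono hxy
    · exact (hcell y h2 (hy0 h2) x h1).1 hxy
    · exact (hcell x h1 (hx0 h1) y h2).2 hxy
    · obtain ⟨z, hz, hxz, hzy⟩ : ∃ z ∈ Z, x < z ∧ z < y := by
        by_contra! hcon
        have hyc : y ∈ signCell Z x := fun z hz =>
          ⟨fun hzx => hzx.trans hxy, fun hxz => lt_of_le_of_ne (hcon z hz hxz)
            (fun hyz => h2 (hyz ▸ hz))⟩
        have := H.sign_sub h1 hyc (mem_signCell_self Z x)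
        rw [hx0 h1, hy0 h2, sub_zero, sign_zero, sign_pos (sub_pos.2 hxy), mul_one, eq_comm,
          sign_eq_zero_iff] at this
        exact H.deriv_ne x h1 this
      exact ((hcell x h1 (hx0 h1) z hz).2 hxz).trans ((hcell y h2 (hy0 h2) z hz).1 hzy)
  obtain ⟨g, hg⟩ := exists_orderIso_eqOn _ e he
  have hgZ : ∀ z ∈ Z, g z = h z := fun z hz => by
    rw [hg z (Finset.mem_union_left _ hz)]
    simp [e, hz]
  refine ⟨g, hgZ, fun t => ?_⟩
  by_cases ht : t ∈ Z
  · rw [hgZ t ht]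
    exact H.sign_eq t ht
  have hgt : g t ∈ signCell (Z.image h) (h t) :=
    (signCell_image_congr hgZ t t).2 (mem_signCell_self Z t)
  by_cases hr : ∃ r ∈ signCell Z t, a.eval r = 0
  · obtain ⟨r, hrt, hr0⟩ := hr
    have hrZ := notMem_of_mem_signCell ht hrt
    have ha0 : a ≠ 0 := by
      rintro rfl
      exact H.deriv_ne t ht (by simp)
    have hgr : g r = ρ r := by
      rw [hg r (Finset.mem_union_right _ (by simp [ha0, hr0]))]
      simp [e, hrZ]
    have h1 := H.sign_sub ht (mem_signCell_self Z t) hrt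
    have h2 := H.symm.sign_sub (SignStep.image_notMem ht) hgt
      ((signCell_image_congr hgZ r t).2 hrt)
    rw [hr0, sub_zero] at h1
    rw [hgr, hρ0 r hrZ hr0, sub_zero, ← hgr] at h2
    rw [h1, h2, H.deriv_sign]
    congr 1
    rcases lt_trichotomy t r with h3 | rfl | h3
    · rw [sign_neg (sub_neg.2 h3), sign_neg (sub_neg.2 (g.strictMono h3))]
    · simp
    · rw [sign_pos (sub_pos.2 h3), sign_pos (sub_pos.2 (g.strictMono h3))]
  · push Not at hr
    have hb : ∀ x ∈ signCell (Z.image h) (h t), b.eval x ≠ 0 := by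
      intro x hx hx0
      obtain ⟨s, hs, hs0⟩ := H.exists_root_left ht hx hx0
      exact hr s hs hs0
    rcases lt_or_gt_of_ne (hr t (mem_signCell_self Z t)) with h1 | h1
    · obtain ⟨s', hs', h2⟩ := H.exists_neg' ht (mem_signCell_self Z t) h1
      rw [polynomial_eval_ne_zero_sign_eq (ordConnected_signCell _ _) hb hgt hs', sign_neg h1,
        sign_neg h2]
    · obtain ⟨s', hs', h2⟩ := H.exists_pos' ht (mem_signCell_self Z t) h1
      rw [polynomial_eval_ne_zero_sign_eq (ordConnected_signCell _ _) hb hgt hs', sign_pos h1,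
        sign_pos h2]

end SignCells

section SignDetermined

open Polynomial

variable {A : Type*} [CommRing A]

/-- The specializations of `F` along `y` and `y'` have the same signs up to a reparametrization
of the line. -/
def SignEquiv (F : Finset A[X]) (y y' : A →+* ℝ) : Prop :=
  ∃ h : ℝ ≃o ℝ, ∀ f ∈ F, ∀ t,
    SignType.sign ((f.map y).eval t) = SignType.sign ((f.map y').eval (h t))

/-- The sign behaviour of `F` is determined by the signs of finitely many coefficients. -/
def SignDetermined (F : Finset A[X]) : Prop :=
  ∃ C : Finset A, ∀ y y' : A →+* ℝ,
    (∀ c ∈ C, SignType.sign (y c) = SignType.sign (y' c)) → SignEquiv F y y'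

lemma SignDetermined.mono {F F' : Finset A[X]} (h : SignDetermined F') (hF : F ⊆ F') :
    SignDetermined F := by
  obtain ⟨C, hC⟩ := h
  refine ⟨C, fun y y' hy => ?_⟩
  obtain ⟨e, he⟩ := hC y y' hy
  exact ⟨e, fun f hf => he f (hF hf)⟩

lemma map_eraseLead_of_leadingCoeff_eq_zero {f : A[X]} {y : A →+* ℝ} (h : y f.leadingCoeff = 0) :
    f.eraseLead.map y = f.map y := by
  conv_rhs => rw [← f.eraseLead_add_monomial_natDegree_leadingCoeff, Polynomial.map_add,
    map_monomial, h, monomial_zero_right, add_zero]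

lemma exists_truncations (g : A[X]) : ∃ T : Finset A[X], g ∈ T ∧
    (∀ q ∈ T, q = g ∨ q.natDegree < g.natDegree) ∧
    ∀ y : A →+* ℝ, g.map y ≠ 0 → ∃ q ∈ T, q.map y = g.map y ∧ y q.leadingCoeff ≠ 0 := by
  classical
  induction hn : g.natDegree using Nat.strong_induction_on generalizing g with
  | _ n ih =>
    subst hn
    rcases g.eraseLead_natDegree_lt_or_eraseLead_eq_zero with hlt | h0
    · obtain ⟨T, h1, h2, h3⟩ := ih _ hlt _ rfl
      refine ⟨insert g T, Finset.mem_insert_self _ _, ?_, ?_⟩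
      · intro q hq
        rcases Finset.mem_insert.1 hq with rfl | hq
        · exact Or.inl rfl
        · rcases h2 q hq with rfl | h
          · exact Or.inr hlt
          · exact Or.inr (h.trans hlt)
      · intro y hy
        by_cases hl : y g.leadingCoeff = 0
        · have he := map_eraseLead_of_leadingCoeff_eq_zero hl
          obtain ⟨q, hq, hq1, hq2⟩ := h3 y (he ▸ hy)
          exact ⟨q, Finset.mem_insert_of_mem hq, hq1.trans he, hq2⟩
        · exact ⟨g, Finset.mem_insert_self _ _, rfl, hl⟩
    · refine ⟨{g}, by simp, by simp, fun y hy => ⟨g, by simp, rfl, fun hl => hy ?_⟩⟩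
      rw [← map_eraseLead_of_leadingCoeff_eq_zero hl, h0, Polynomial.map_zero]

/-- One step of division of `f` by `g`, scaled so as not to change signs at roots of `g`. -/
noncomputable def reduceStep (f g : A[X]) : A[X] :=
  C (g.leadingCoeff ^ 2) * f -
    C (g.leadingCoeff * f.leadingCoeff) * (X ^ (f.natDegree - g.natDegree) * g)

lemma natDegree_reduceStep_le {f g : A[X]} {d : ℕ} (hf : f.natDegree = d + 1)
    (hg : g.natDegree ≤ d + 1) : (reduceStep f g).natDegree ≤ d := by
  rw [natDegree_le_iff_coeff_eq_zero]
  intro N hN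
  obtain ⟨k, rfl⟩ : ∃ k, N = k + (f.natDegree - g.natDegree) := ⟨N - (f.natDegree - g.natDegree),
    by omega⟩
  rw [reduceStep, coeff_sub, coeff_C_mul, coeff_C_mul, coeff_X_pow_mul]
  rcases Nat.lt_or_ge g.natDegree k with h | h
  · rw [coeff_eq_zero_of_natDegree_lt h, coeff_eq_zero_of_natDegree_lt (by omega)]
    simp
  · have h1 : k = g.natDegree := by omega
    have h2 : k + (f.natDegree - g.natDegree) = f.natDegree := by omega
    rw [h2, h1, coeff_natDegree, coeff_natDegree]
    ring

lemma sign_eval_reduceStep {f g : A[X]} {y : A →+* ℝ} {t : ℝ} (ht : (g.map y).eval t = 0)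
    (hg : y g.leadingCoeff ≠ 0) : SignType.sign (((reduceStep f g).map y).eval t) =
      SignType.sign ((f.map y).eval t) := by
  have : ((reduceStep f g).map y).eval t = (y g.leadingCoeff) ^ 2 * (f.map y).eval t := by
    simp [reduceStep, ht]
  rw [this, sign_mul, sign_pos (by positivity), one_mul]

lemma signEquiv_insert [DecidableEq A[X]] {G F : Finset A[X]} {f : A[X]} {y y' : A →+* ℝ}
    (hfd : f.natDegree ≠ 0) (hGF : G ⊆ F) (hfF : f.derivative ∈ F) (heF : f.eraseLead ∈ F)
    (hF : SignEquiv F y y') (hlc : SignType.sign (y f.leadingCoeff) =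
      SignType.sign (y' f.leadingCoeff))
    (hred : ∀ g ∈ insert f.derivative G, g.map y ≠ 0 → ∃ q ∈ F, q.map y = g.map y ∧
      y q.leadingCoeff ≠ 0 ∧ y' q.leadingCoeff ≠ 0 ∧ reduceStep f q ∈ F) :
    SignEquiv (insert f G) y y' := by
  obtain ⟨h, hh⟩ := hF
  by_cases hl : y f.leadingCoeff = 0
  · have hl' : y' f.leadingCoeff = 0 := by
      rwa [hl, sign_zero, eq_comm, sign_eq_zero_iff] at hlc
    refine ⟨h, fun p hp t => ?_⟩
    rcases Finset.mem_insert.1 hp with rfl | hp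
    · rw [← map_eraseLead_of_leadingCoeff_eq_zero hl, ← map_eraseLead_of_leadingCoeff_eq_zero hl']
      exact hh _ heF t
    · exact hh _ (hGF hp) t
  set Z : Finset ℝ := (insert f.derivative G).biUnion fun g => (g.map y).roots.toFinset with hZ
  have hmemZ : ∀ z, z ∈ Z ↔ ∃ g ∈ insert f.derivative G, g.map y ≠ 0 ∧ (g.map y).eval z = 0 := by
    intro z
    simp only [hZ, Finset.mem_biUnion, Multiset.mem_toFinset, mem_roots', IsRoot.def]
  have hd0 : (f.map y).derivative ≠ 0 := by
    intro h0
    have := derivative_eq_zero.1 h0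
    rw [natDegree_map_of_leadingCoeff_ne_zero y hl] at this
    exact hfd this
  have H : SignStep Z h (f.map y) (f.map y') := by
    refine ⟨?_, ?_, ?_⟩
    · intro z hz
      obtain ⟨g, hg, hg0, hgz⟩ := (hmemZ z).1 hz
      obtain ⟨q, hq, hqg, hq1, hq2, hq3⟩ := hred g hg hg0
      rw [← hqg] at hgz
      have hqz : (q.map y').eval (h z) = 0 := by
        have := hh q hq z
        rwa [hgz, sign_zero, eq_comm, sign_eq_zero_iff] at this
      rw [← sign_eval_reduceStep hgz hq1, ← sign_eval_reduceStep hqz hq2]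
      exact hh _ hq3 z
    · intro t ht h0
      rw [derivative_map] at h0 hd0
      exact ht ((hmemZ t).2 ⟨f.derivative, Finset.mem_insert_self _ _, hd0, h0⟩)
    · intro t
      rw [derivative_map, derivative_map]
      exact hh _ hfF t
  obtain ⟨g, hgZ, hg⟩ := H.exists_orderIso
  refine ⟨g, fun p hp t => ?_⟩
  rcases Finset.mem_insert.1 hp with rfl | hp
  · exact hg t
  have hhp := hh p (hGF hp)
  by_cases ht : t ∈ Z
  · rw [hgZ t ht]
    exact hhp t
  by_cases hp0 : p.map y = 0
  · have := hhp (h.symm (g t))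
    rw [OrderIso.apply_symm_apply, hp0] at this
    rw [← this, hp0]
    simp
  · rw [hhp t]
    refine polynomial_eval_ne_zero_sign_eq (ordConnected_signCell (Z.image h) (h t)) ?_
      (mem_signCell_self _ _) ((signCell_image_congr hgZ t t).2 (mem_signCell_self Z t))
    intro x hx hx0
    refine notMem_of_mem_signCell (SignStep.image_notMem ht) hx ?_
    refine Finset.mem_image.2 ⟨h.symm x, (hmemZ _).2 ⟨p, Finset.mem_insert_of_mem hp, hp0, ?_⟩,
      by simp⟩
    have := hhp (h.symm x)
    rwa [OrderIso.apply_symm_apply, hx0, sign_zero, sign_eq_zero_iff] at this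

lemma signDetermined_union [DecidableEq A[X]] {d : ℕ}
    (hd : ∀ F : Finset A[X], (∀ f ∈ F, f.natDegree ≤ d) → SignDetermined F) (T : Finset A[X]) :
    ∀ G : Finset A[X], (∀ f ∈ G, f.natDegree ≤ d) → (∀ f ∈ T, f.natDegree ≤ d + 1) →
      SignDetermined (G ∪ T) := by
  classical
  induction T using Finset.induction_on with
  | empty =>
    intro G hG _
    simpa using hd G hG
  | insert f T hfT ih =>
    intro G hG hT
    have hT' : ∀ q ∈ T, q.natDegree ≤ d + 1 := fun q hq => hT q (Finset.mem_insert_of_mem hq)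
    by_cases hfd : f.natDegree ≤ d
    · refine (ih (insert f G) ?_ hT').mono ?_
      · simpa [hfd] using hG
      · intro q
        simp only [Finset.mem_union, Finset.mem_insert]
        tauto
    have hfd' : f.natDegree = d + 1 := le_antisymm (hT f (Finset.mem_insert_self _ _)) (by omega)
    choose τ hτ1 hτ2 hτ3 using exists_truncations (A := A)
    set B := (insert f.derivative (G ∪ T)).biUnion τ with hB
    set F := insert f.eraseLead (B ∪ B.image (reduceStep f)) with hF
    have hder : f.derivative.natDegree ≤ d := by
      have := natDegree_derivative_le f
      omega
    have hBdeg : ∀ q ∈ B, q.natDegree ≤ d ∨ q ∈ T := by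
      intro q hq
      obtain ⟨g, hg, hqg⟩ := Finset.mem_biUnion.1 hq
      simp only [Finset.mem_insert, Finset.mem_union] at hg
      rcases hτ2 g q hqg with rfl | hlt
      · rcases hg with rfl | hg | hg
        · exact Or.inl hder
        · exact Or.inl (hG _ hg)
        · exact Or.inr hg
      · left
        rcases hg with rfl | hg | hg
        · omega
        · have := hG _ hg
          omega
        · have := hT' _ hg
          omega
    have hFdeg : F ⊆ F.filter (fun q => q.natDegree ≤ d) ∪ T := by
      intro q hq
      suffices q.natDegree ≤ d ∨ q ∈ T by
        rw [Finset.mem_union, Finset.mem_filter]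
        tauto
      simp only [hF, Finset.mem_insert, Finset.mem_union, Finset.mem_image] at hq
      rcases hq with rfl | hq | ⟨g, hg, rfl⟩
      · left
        have := f.eraseLead_natDegree_le
        omega
      · exact hBdeg q hq
      · left
        refine natDegree_reduceStep_le hfd' ?_
        rcases hBdeg g hg with h | h
        · omega
        · exact hT' g h
    obtain ⟨C, hC⟩ := (ih (F.filter fun q => q.natDegree ≤ d) (by simp) hT').mono hFdeg
    have hsub : ∀ g ∈ insert f.derivative (G ∪ T), g ∈ F := by
      intro g hg
      refine Finset.mem_insert_of_mem (Finset.mem_union_left _ ?_)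
      exact Finset.mem_biUnion.2 ⟨g, hg, hτ1 g⟩
    refine ⟨insert f.leadingCoeff (C ∪ F.image leadingCoeff), fun y y' hy => ?_⟩
    have hFy := hC y y' fun c hc => hy c (by simp [hc])
    rw [Finset.union_insert]
    refine signEquiv_insert (F := F) (by omega)
      (fun g hg => hsub g (Finset.mem_insert_of_mem hg))
      (hsub _ (Finset.mem_insert_self _ _)) (Finset.mem_insert_self _ _) hFy
      (hy _ (Finset.mem_insert_self _ _)) ?_
    intro g hg hg0
    obtain ⟨q, hq, hq1, hq2⟩ := hτ3 g y hg0
    have hqB : q ∈ B := Finset.mem_biUnion.2 ⟨g, hg, hq⟩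
    have hqF : q ∈ F := Finset.mem_insert_of_mem (Finset.mem_union_left _ hqB)
    refine ⟨q, hqF, hq1, hq2, fun h0 => hq2 ?_, ?_⟩
    · have := hy q.leadingCoeff (Finset.mem_insert_of_mem
        (Finset.mem_union_right _ (Finset.mem_image_of_mem _ hqF)))
      rwa [h0, sign_zero, sign_eq_zero_iff] at this
    · exact Finset.mem_insert_of_mem
        (Finset.mem_union_right _ (Finset.mem_image_of_mem _ hqB))

/-- **Tarski–Seidenberg**, sign form: the signs of finitely many coefficients determine the
sign behaviour of a finite family of polynomials. -/
theorem signDetermined (F : Finset A[X]) : SignDetermined F := by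
  classical
  suffices h : ∀ d, ∀ F : Finset A[X], (∀ f ∈ F, f.natDegree ≤ d) → SignDetermined F from
    h (F.sup natDegree) F fun f hf => Finset.le_sup hf
  intro d
  induction d with
  | zero =>
    intro F hF
    refine ⟨F.image fun f => f.coeff 0, fun y y' hy => ⟨OrderIso.refl ℝ, fun f hf t => ?_⟩⟩
    rw [eq_C_of_natDegree_le_zero (hF f hf)]
    simpa using hy _ (Finset.mem_image_of_mem _ hf)
  | succ d ih =>
    intro F hF
    simpa using signDetermined_union ih F ∅ (by simp) hF

end SignDetermined

section Semialgebraic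

open MvPolynomial

variable {σ τ : Type} [Fintype σ] [Fintype τ]

lemma IsSemialgebraic.of_finite {ι : Type*} [Finite ι] (p : ι → MvPolynomial σ ℝ)
    (q : ι → Finset (MvPolynomial σ ℝ)) :
    IsSemialgebraic (⋃ i, {x | eval x (p i) = 0 ∧ ∀ r ∈ q i, 0 < eval x r}) := by
  obtain ⟨k, ⟨e⟩⟩ := Finite.exists_equiv_fin ι
  refine ⟨k, p ∘ e.symm, q ∘ e.symm, ?_⟩
  exact (e.symm.surjective.iUnion_comp
    (fun i => {x | eval x (p i) = 0 ∧ ∀ r ∈ q i, 0 < eval x r})).symm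

lemma IsSemialgebraic.basic (p : MvPolynomial σ ℝ) (q : Finset (MvPolynomial σ ℝ)) :
    IsSemialgebraic {x | eval x p = 0 ∧ ∀ r ∈ q, 0 < eval x r} := by
  have := IsSemialgebraic.of_finite (ι := Unit) (fun _ => p) (fun _ => q)
  rwa [Set.iUnion_const] at this

lemma IsSemialgebraic.zero_locus (p : MvPolynomial σ ℝ) :
    IsSemialgebraic {x | eval x p = 0} := by
  simpa using IsSemialgebraic.basic p ∅

lemma IsSemialgebraic.univ : IsSemialgebraic (Set.univ : Set (σ → ℝ)) := by
  simpa using IsSemialgebraic.basic (σ := σ) 0 ∅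

lemma IsSemialgebraic.empty : IsSemialgebraic (∅ : Set (σ → ℝ)) := by
  simpa using IsSemialgebraic.basic (σ := σ) 1 ∅

lemma IsSemialgebraic.union {S T : Set (σ → ℝ)} (hS : IsSemialgebraic S)
    (hT : IsSemialgebraic T) : IsSemialgebraic (S ∪ T) := by
  obtain ⟨k, p, q, rfl⟩ := hS
  obtain ⟨l, p', q', rfl⟩ := hT
  simpa [Set.iUnion_sum] using IsSemialgebraic.of_finite (Sum.elim p p') (Sum.elim q q')

lemma IsSemialgebraic.inter {S T : Set (σ → ℝ)} (hS : IsSemialgebraic S)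
    (hT : IsSemialgebraic T) : IsSemialgebraic (S ∩ T) := by
  classical
  obtain ⟨k, p, q, rfl⟩ := hS
  obtain ⟨l, p', q', rfl⟩ := hT
  convert IsSemialgebraic.of_finite (ι := Fin k × Fin l)
    (fun i => p i.1 * p i.1 + p' i.2 * p' i.2) (fun i => q i.1 ∪ q' i.2) using 1
  ext x
  simp only [Set.mem_inter_iff, Set.mem_iUnion, Set.mem_ofPred_eq, map_add, map_mul,
    mul_self_add_mul_self_eq_zero, Finset.mem_union, Prod.exists]
  constructor
  · rintro ⟨⟨i, h1, h2⟩, ⟨j, h3, h4⟩⟩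
    exact ⟨i, j, ⟨h1, h3⟩, fun r hr => hr.elim (h2 r) (h4 r)⟩
  · rintro ⟨i, j, ⟨h1, h3⟩, h⟩
    exact ⟨⟨i, h1, fun r hr => h r (Or.inl hr)⟩, ⟨j, h3, fun r hr => h r (Or.inr hr)⟩⟩

lemma IsSemialgebraic.biUnion {ι : Type*} {I : Set ι} (hI : I.Finite) {S : ι → Set (σ → ℝ)}
    (hS : ∀ i ∈ I, IsSemialgebraic (S i)) : IsSemialgebraic (⋃ i ∈ I, S i) := by
  induction I, hI using Set.Finite.induction_on with
  | empty => simpa using IsSemialgebraic.empty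
  | insert _ _ ih =>
    rw [Set.biUnion_insert]
    exact (hS _ (Set.mem_insert _ _)).union (ih fun i hi => hS i (Set.mem_insert_of_mem _ hi))

lemma IsSemialgebraic.biInter {ι : Type*} {I : Set ι} (hI : I.Finite) {S : ι → Set (σ → ℝ)}
    (hS : ∀ i ∈ I, IsSemialgebraic (S i)) : IsSemialgebraic (⋂ i ∈ I, S i) := by
  induction I, hI using Set.Finite.induction_on with
  | empty => simpa using IsSemialgebraic.univ
  | insert _ _ ih =>
    rw [Set.biInter_insert]
    exact (hS _ (Set.mem_insert _ _)).inter (ih fun i hi => hS i (Set.mem_insert_of_mem _ hi))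

lemma IsSemialgebraic.preimage {S : Set (σ → ℝ)} (hS : IsSemialgebraic S)
    (f : σ → MvPolynomial τ ℝ) : IsSemialgebraic {x : τ → ℝ | (fun j => eval x (f j)) ∈ S} := by
  classical
  obtain ⟨k, p, q, rfl⟩ := hS
  convert IsSemialgebraic.of_finite (fun i => bind₁ f (p i))
    (fun i => (q i).image (bind₁ f)) using 1
  have hev : ∀ (x : τ → ℝ) (r : MvPolynomial σ ℝ),
      eval x (bind₁ f r) = eval (fun j => eval x (f j)) r := fun x r =>
    eval₂Hom_bind₁ (RingHom.id ℝ) x f r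
  ext x
  simp [hev]

lemma IsSemialgebraic.sign_eq (p : MvPolynomial σ ℝ) (s : SignType) :
    IsSemialgebraic {x | SignType.sign (eval x p) = s} := by
  cases s with
  | zero =>
    have := IsSemialgebraic.zero_locus p
    simpa [SignType.zero_eq_zero, sign_eq_zero_iff] using this
  | neg =>
    have := IsSemialgebraic.basic 0 {-p}
    simpa [SignType.neg_eq_neg_one, sign_eq_neg_one_iff] using this
  | pos =>
    have := IsSemialgebraic.basic 0 {p}
    simpa [SignType.pos_eq_one, sign_eq_one_iff] using this

/-- A set, membership in which depends only on the signs of finitely many polynomials, is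
semialgebraic. -/
lemma IsSemialgebraic.of_sign_determined {S : Set (σ → ℝ)} (C : Finset (MvPolynomial σ ℝ))
    (hC : ∀ x x', (∀ c ∈ C, SignType.sign (eval x c) = SignType.sign (eval x' c)) →
      x ∈ S → x' ∈ S) : IsSemialgebraic S := by
  let v : (σ → ℝ) → C → SignType := fun x c => SignType.sign (eval x c.1)
  have : S = ⋃ s ∈ v '' S, ⋂ c ∈ (Set.univ : Set C), {x | SignType.sign (eval x c.1) = s c} := by
    ext x
    simp only [Set.mem_iUnion, Set.mem_iInter, Set.mem_univ, true_imp_iff, Set.mem_ofPred_eq,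
      Set.mem_image, exists_prop]
    constructor
    · exact fun hx => ⟨v x, ⟨x, hx, rfl⟩, fun _ => rfl⟩
    · rintro ⟨_, ⟨x', hx', rfl⟩, h⟩
      exact hC x' x (fun c hc => (h ⟨c, hc⟩).symm) hx'
  rw [this]
  exact IsSemialgebraic.biUnion (Set.toFinite _) fun s _ =>
    IsSemialgebraic.biInter (Set.toFinite _) fun c _ => IsSemialgebraic.sign_eq _ _

/-- View a multivariate polynomial as a univariate one in the variable `i`. -/
noncomputable def asUnivariate [DecidableEq σ] (i : σ) :
    MvPolynomial σ ℝ →ₐ[ℝ] Polynomial (MvPolynomial σ ℝ) :=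
  aeval fun j => if j = i then Polynomial.X else Polynomial.C (X j)

lemma eval_asUnivariate {σ : Type} [DecidableEq σ] (i : σ) (x : σ → ℝ) (t : ℝ)
    (p : MvPolynomial σ ℝ) :
    ((asUnivariate i p).map (eval x)).eval t = eval (Function.update x i t) p := by
  induction p using MvPolynomial.induction_on with
  | C a =>
    rw [← MvPolynomial.algebraMap_eq, AlgHom.commutes, Polynomial.algebraMap_apply]
    simp
  | add p q hp hq => simp [hp, hq]
  | mul_X p j hp =>
    rw [map_mul, Polynomial.map_mul, Polynomial.eval_mul, hp, map_mul]
    congr 1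
    by_cases h : j = i
    · subst h
      simp [asUnivariate]
    · simp [asUnivariate, h]

/-- **Tarski–Seidenberg**: eliminating one existentially quantified real coordinate. -/
theorem IsSemialgebraic.exists_update [DecidableEq σ] {S : Set (σ → ℝ)} (hS : IsSemialgebraic S)
    (i : σ) : IsSemialgebraic {x | ∃ t, Function.update x i t ∈ S} := by
  classical
  obtain ⟨k, p, q, rfl⟩ := hS
  let F : Finset (Polynomial (MvPolynomial σ ℝ)) :=
    (Finset.univ.biUnion fun j => insert (p j) (q j)).image (asUnivariate i)
  obtain ⟨C, hC⟩ := signDetermined F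
  refine IsSemialgebraic.of_sign_determined C ?_
  rintro x x' hxx' ⟨t, ht⟩
  obtain ⟨h, hh⟩ := hC (eval x) (eval x') hxx'
  have key : ∀ j, ∀ r ∈ insert (p j) (q j),
      SignType.sign (eval (Function.update x i t) r) =
        SignType.sign (eval (Function.update x' i (h t)) r) := by
    intro j r hr
    rw [← eval_asUnivariate, ← eval_asUnivariate]
    exact hh _ (Finset.mem_image_of_mem _ (Finset.mem_biUnion.2 ⟨j, Finset.mem_univ _, hr⟩)) t
  obtain ⟨j, h1, h2⟩ := Set.mem_iUnion.1 ht
  refine ⟨h t, Set.mem_iUnion.2 ⟨j, ?_, fun r hr => ?_⟩⟩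
  · have := key j (p j) (Finset.mem_insert_self _ _)
    rwa [h1, sign_zero, eq_comm, sign_eq_zero_iff] at this
  · have := key j r (Finset.mem_insert_of_mem hr)
    rw [sign_pos (h2 r hr)] at this
    exact sign_eq_one_iff.1 this.symm

lemma IsSemialgebraic.exists_agree_off {S : Set (σ → ℝ)} (hS : IsSemialgebraic S)
    (s : Finset σ) : IsSemialgebraic {x | ∃ x' ∈ S, ∀ j ∉ s, x' j = x j} := by
  classical
  induction s using Finset.induction_on with
  | empty =>
    convert hS using 1
    ext x
    constructor
    · rintro ⟨x', h, h'⟩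
      rwa [← (funext fun j => h' j (Finset.notMem_empty j) : x' = x)]
    · exact fun h => ⟨x, h, fun _ _ => rfl⟩
  | insert i s hi ih =>
    convert ih.exists_update i using 1
    ext x
    constructor
    · rintro ⟨x', h, h'⟩
      refine ⟨x' i, x', h, fun j hj => ?_⟩
      by_cases hji : j = i
      · subst hji
        simp
      · rw [Function.update_of_ne hji]
        exact h' j (by simp [hji, hj])
    · rintro ⟨t, x', h, h'⟩
      refine ⟨x', h, fun j hj => ?_⟩
      rw [Finset.mem_insert, not_or] at hj
      rw [h' j hj.2, Function.update_of_ne hj.1]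

/-- **Tarski–Seidenberg**: projections of semialgebraic sets are semialgebraic. -/
theorem IsSemialgebraic.exists_elim {S : Set (σ ⊕ τ → ℝ)} (hS : IsSemialgebraic S) :
    IsSemialgebraic {x : σ → ℝ | ∃ y : τ → ℝ, Sum.elim x y ∈ S} := by
  classical
  convert (hS.exists_agree_off (Finset.univ.filter fun j => j.isRight)).preimage
    (τ := σ) (Sum.elim X fun _ => 0) using 1
  ext x
  constructor
  · rintro ⟨y, hy⟩
    refine ⟨_, hy, ?_⟩
    rintro (j | j) hj
    · simp
    · simp at hj
  · rintro ⟨x', hx', h⟩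
    refine ⟨x' ∘ Sum.inr, ?_⟩
    convert hx' using 1
    funext j
    rcases j with j | j
    · simpa using (h (Sum.inl j) (by simp)).symm
    · rfl

/-- The image of a semialgebraic set under a polynomial map is semialgebraic. -/
theorem IsSemialgebraic.image {S : Set (τ → ℝ)} (hS : IsSemialgebraic S)
    (f : σ → MvPolynomial τ ℝ) : IsSemialgebraic ((fun x j => eval x (f j)) '' S) := by
  have h1 := hS.preimage (τ := σ ⊕ τ) (fun j => X (Sum.inr j))
  have h2 := IsSemialgebraic.biInter (Set.finite_univ (α := σ)) fun j _ =>
    IsSemialgebraic.zero_locus (X (Sum.inl j) - rename (Sum.inr : τ → σ ⊕ τ) (f j))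
  convert (h1.inter h2).exists_elim using 1
  ext y
  simp only [Set.mem_image, Set.mem_ofPred_eq, Set.mem_inter_iff, Set.mem_iInter, Set.mem_univ,
    true_imp_iff, eval_X, Sum.elim_inr, map_sub, Sum.elim_inl, eval_rename, Sum.elim_comp_inr,
    sub_eq_zero]
  refine exists_congr fun x => and_congr_right fun _ => ?_
  rw [funext_iff]
  exact forall_congr' fun j => eq_comm

end Semialgebraic

section CompactGroups

open MvPolynomial MeasureTheory

/-- A continuous family of polynomials, indexed by a compact measure space, integrates to a
polynomial. -/
lemma exists_eval_eq_integral {K κ : Type*} [TopologicalSpace K] [CompactSpace K]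
    [MeasurableSpace K] [BorelSpace K] (μ : Measure K) [IsFiniteMeasure μ]
    (P : MvPolynomial κ C(K, ℝ)) :
    ∃ F : MvPolynomial κ ℝ, ∀ x : κ → ℝ,
      Continuous (fun k => eval x (map (ContinuousMap.evalAlgHom ℝ ℝ k).toRingHom P)) ∧
      eval x F = ∫ k, eval x (map (ContinuousMap.evalAlgHom ℝ ℝ k).toRingHom P) ∂μ := by
  induction P using MvPolynomial.induction_on' with
  | monomial u a =>
    refine ⟨monomial u (∫ k, a k ∂μ), fun x => ?_⟩
    simp only [map_monomial, eval_monomial]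
    exact ⟨a.continuous.mul continuous_const, (integral_mul_const _ _).symm⟩
  | add p q hp hq =>
    obtain ⟨F, hF⟩ := hp
    obtain ⟨G, hG⟩ := hq
    refine ⟨F + G, fun x => ?_⟩
    simp only [map_add]
    refine ⟨(hF x).1.add (hG x).1, ?_⟩
    rw [(hF x).2, (hG x).2, integral_add]
    · exact (hF x).1.integrable_of_hasCompactSupport (HasCompactSupport.of_compactSpace _)
    · exact (hG x).1.integrable_of_hasCompactSupport (HasCompactSupport.of_compactSpace _)

/-- Polynomials separate disjoint compact subsets of `ℝ^κ`. -/
lemma exists_polynomial_separating {κ : Type} [Fintype κ] {S T : Set (κ → ℝ)}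
    (hS : IsCompact S) (hT : IsCompact T) (hST : Disjoint S T) :
    ∃ f : MvPolynomial κ ℝ, (∀ x ∈ S, eval x f ≤ 1 / 4) ∧ ∀ x ∈ T, 3 / 4 ≤ eval x f := by
  obtain ⟨f₀, h0, h1, -⟩ := exists_continuous_zero_one_of_isClosed hS.isClosed hT.isClosed hST
  let coord : κ → C(κ → ℝ, ℝ) := fun j => ⟨fun x => x j, continuous_apply j⟩
  let Φ : MvPolynomial κ ℝ →ₐ[ℝ] C(κ → ℝ, ℝ) := aeval coord
  have hΦ : ∀ f x, Φ f x = eval x f := by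
    intro f x
    induction f using MvPolynomial.induction_on with
    | C a => simp [Φ]
    | add p q hp hq => simp [hp, hq]
    | mul_X p j hp =>
      rw [map_mul, ContinuousMap.mul_apply, hp]
      simp [Φ, coord]
  have hsep : Φ.range.SeparatesPoints := by
    intro x y hxy
    obtain ⟨j, hj⟩ := Function.ne_iff.1 hxy
    refine ⟨_, ⟨Φ (X j), ⟨X j, rfl⟩, rfl⟩, ?_⟩
    simpa [hΦ] using hj
  obtain ⟨_, ⟨f, rfl⟩, hf⟩ :=
    ContinuousMap.exists_mem_subalgebra_near_continuous_of_isCompact_of_separatesPoints hsep f₀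
      (hS.union hT) (ε := 1 / 4) (by norm_num)
  refine ⟨f, fun x hx => ?_, fun x hx => ?_⟩
  · have := hf x (Or.inl hx)
    rw [h0 hx, AlgHom.toRingHom_eq_coe, RingHom.coe_coe, hΦ, Real.norm_eq_abs, abs_lt] at this
    simp only [Pi.zero_apply] at this
    linarith
  · have := hf x (Or.inr hx)
    rw [h1 hx, AlgHom.toRingHom_eq_coe, RingHom.coe_coe, hΦ, Real.norm_eq_abs, abs_lt] at this
    simp only [Pi.one_apply] at this
    linarith

variable {K : Type*} [Group K] [TopologicalSpace K] [IsTopologicalGroup K] [CompactSpace K]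
  {ι : Type} [Fintype ι] [DecidableEq ι]

/-- Off the image of a compact group some polynomial vanishing on the image does not vanish. -/
lemma exists_polynomial_vanishing_on_range (ρ : K →* Matrix ι ι ℝ) (hρ : Continuous ρ)
    {g : Matrix ι ι ℝ} (hg : g ∉ Set.range ρ) : ∃ F : MvPolynomial (ι × ι) ℝ,
      (∀ k, eval (fun p => ρ k p.1 p.2) F = 0) ∧ eval (fun p => g p.1 p.2) F ≠ 0 := by
  let _ : MeasurableSpace K := borel K
  have : BorelSpace K := ⟨rfl⟩
  let μ : Measure K := Measure.haarMeasure ⊤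
  have hμ1 : μ Set.univ = 1 := by
    simpa using Measure.haarMeasure_self (K₀ := (⊤ : TopologicalSpace.PositiveCompacts K))
  have : IsProbabilityMeasure μ := ⟨hμ1⟩
  let vec : Matrix ι ι ℝ → (ι × ι → ℝ) := fun M p => M p.1 p.2
  have hvec : Continuous vec := by
    refine continuous_pi fun p => ?_
    exact continuous_id.matrix_elem p.1 p.2
  have hinj : Function.Injective vec := by
    intro M N h
    ext i j
    exact congrFun h (i, j)
  have hc1 : Continuous fun k => vec (ρ k) := hvec.comp hρ
  have hc2 : Continuous fun k => vec (g * ρ k) := hvec.comp (continuous_const.mul hρ)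
  obtain ⟨f, hf1, hf2⟩ := exists_polynomial_separating (isCompact_range hc1) (isCompact_range hc2)
    (by
      rw [Set.disjoint_left]
      rintro _ ⟨k, rfl⟩ ⟨k', h⟩
      refine hg ⟨k * k'⁻¹, ?_⟩
      have h' : g * ρ k' = ρ k := hinj h
      rw [map_mul, ← h', mul_assoc, ← map_mul, mul_inv_cancel, map_one, mul_one])
  let Q : ι × ι → MvPolynomial (ι × ι) C(K, ℝ) := fun p =>
    ∑ l, X (p.1, l) * C (⟨fun k => ρ k l p.2, hρ.matrix_elem l p.2⟩ : C(K, ℝ))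
  have hQ : ∀ (M : Matrix ι ι ℝ) k, eval (vec M) (map (ContinuousMap.evalAlgHom ℝ ℝ k).toRingHom
      (aeval Q f)) = eval (vec (M * ρ k)) f := by
    intro M k
    generalize f = f'
    induction f' using MvPolynomial.induction_on with
    | C a =>
      rw [← MvPolynomial.algebraMap_eq, AlgHom.commutes, MvPolynomial.algebraMap_apply]
      simp
    | add p q hp hq => simp only [map_add, hp, hq]
    | mul_X p j hp =>
      rw [map_mul, map_mul, map_mul, hp, map_mul]
      congr 1
      simp [Q, vec, Matrix.mul_apply]
  obtain ⟨F, hF⟩ := exists_eval_eq_integral μ (aeval Q f)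
  simp only [AlgHom.toRingHom_eq_coe] at hQ hF
  have hF1 : ∀ M, eval (vec M) F = ∫ k, eval (vec (M * ρ k)) f ∂μ := by
    intro M
    rw [(hF (vec M)).2]
    simp only [hQ]
  have hF2 : ∀ M, Integrable (fun k => eval (vec (M * ρ k)) f) μ := by
    intro M
    have := (hF (vec M)).1
    simp only [hQ] at this
    exact this.integrable_of_hasCompactSupport (HasCompactSupport.of_compactSpace _)
  have hF3 : ∀ k, eval (vec (ρ k)) F = eval (vec 1) F := by
    intro k
    rw [hF1, hF1]
    simp only [← map_mul, one_mul]
    exact integral_mul_left_eq_self (fun k => eval (vec (ρ k)) f) k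
  have hle : eval (vec 1) F ≤ 1 / 4 := by
    rw [hF1]
    refine (integral_mono (hF2 1) (integrable_const (1 / 4)) fun k => ?_).trans (by simp)
    simpa using hf1 _ ⟨k, rfl⟩
  have hge : 3 / 4 ≤ eval (vec g) F := by
    rw [hF1]
    refine le_trans (by simp) (integral_mono (integrable_const (3 / 4)) (hF2 g) fun k => ?_)
    exact hf2 _ ⟨k, rfl⟩
  refine ⟨F - C (eval (vec 1) F), fun k => ?_, ?_⟩
  · rw [map_sub, eval_C, sub_eq_zero]
    exact hF3 k
  · rw [map_sub, eval_C]
    have : 0 < eval (vec g) F - eval (vec 1) F := by linarith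
    exact this.ne'

/-- The image of a compact group in the matrices is an algebraic set. -/
theorem matSemialgebraic_range (ρ : K →* Matrix ι ι ℝ) (hρ : Continuous ρ) :
    MatSemialgebraic (Set.range ρ) := by
  let I : Ideal (MvPolynomial (ι × ι) ℝ) :=
    ⨅ k, RingHom.ker (eval fun p : ι × ι => ρ k p.1 p.2)
  obtain ⟨s, hs⟩ : I.FG := IsNoetherian.noetherian I
  have hmem : ∀ f, f ∈ I ↔ ∀ k, eval (fun p : ι × ι => ρ k p.1 p.2) f = 0 := by
    intro f
    simp [I, RingHom.mem_ker]
  have : {x : ι × ι → ℝ | (Matrix.of fun i j => x (i, j)) ∈ Set.range ρ} =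
      ⋂ f ∈ (s : Set (MvPolynomial (ι × ι) ℝ)), {x | eval x f = 0} := by
    ext x
    simp only [Set.mem_iInter, Set.mem_ofPred_eq, Finset.mem_coe]
    constructor
    · rintro ⟨k, hk⟩ f hf
      have h1 := (hmem f).1 (hs ▸ Ideal.subset_span hf) k
      rw [hk] at h1
      simpa using h1
    · intro h
      by_contra hx
      obtain ⟨F, hF1, hF2⟩ := exists_polynomial_vanishing_on_range ρ hρ hx
      have hle : I ≤ RingHom.ker (eval x) := by
        rw [← hs, Submodule.span_le]
        exact fun f hf => h f hf
      exact hF2 (by simpa using hle ((hmem F).2 hF1))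
  rw [MatSemialgebraic, this]
  exact IsSemialgebraic.biInter s.finite_toSet fun f _ => IsSemialgebraic.zero_locus f

end CompactGroups

section Grammars

variable {T N : Type*}

/-- Derivability of strings from a finite set of context-free rules. -/
def RuleDerives (R : Finset (ContextFreeRule T N)) :
    List (Symbol T N) → List (Symbol T N) → Prop :=
  Relation.ReflTransGen fun u v => ∃ r ∈ R, r.Rewrites u v

/-- The terminal words derivable from a string. -/
def derivedWords (R : Finset (ContextFreeRule T N)) (α : List (Symbol T N)) : Set (List T) :=
  {w | RuleDerives R α (w.map Symbol.terminal)}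

/-- The pairs of terminal words `(x, y)` such that `x A y` is derivable from `A`. -/
def derivedContexts (R : Finset (ContextFreeRule T N)) (A : N) : Set (List T × List T) :=
  {c | RuleDerives R [.nonterminal A]
    (c.1.map Symbol.terminal ++ [.nonterminal A] ++ c.2.map Symbol.terminal)}

variable {R R' : Finset (ContextFreeRule T N)} {u v w p q α β : List (Symbol T N)} {A : N}

lemma RuleDerives.trans (h₁ : RuleDerives R u v) (h₂ : RuleDerives R v w) : RuleDerives R u w :=
  Relation.ReflTransGen.trans h₁ h₂

lemma RuleDerives.mono (h : R ⊆ R') (hd : RuleDerives R u v) : RuleDerives R' u v :=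
  Relation.ReflTransGen.mono (fun _ _ ⟨r, hr, hrw⟩ => ⟨r, h hr, hrw⟩) _ _ hd

lemma RuleDerives.append_left (h : RuleDerives R u v) (p : List (Symbol T N)) :
    RuleDerives R (p ++ u) (p ++ v) :=
  Relation.ReflTransGen.lift (p ++ ·) (fun _ _ ⟨r, hr, hrw⟩ => ⟨r, hr, hrw.append_left p⟩) _ _ h

lemma RuleDerives.append_right (h : RuleDerives R u v) (p : List (Symbol T N)) :
    RuleDerives R (u ++ p) (v ++ p) :=
  Relation.ReflTransGen.lift (· ++ p) (fun _ _ ⟨r, hr, hrw⟩ => ⟨r, hr, hrw.append_right p⟩) _ _ h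

lemma RuleDerives.append {u' v' : List (Symbol T N)} (h : RuleDerives R u v)
    (h' : RuleDerives R u' v') : RuleDerives R (u ++ u') (v ++ v') :=
  (h.append_right u').trans (h'.append_left v)

lemma RuleDerives.of_rule {r : ContextFreeRule T N} (hr : r ∈ R) :
    RuleDerives R [.nonterminal r.input] r.output :=
  Relation.ReflTransGen.single ⟨r, hr, .input_output⟩

/-- A derivation from a concatenation splits. -/
lemma RuleDerives.exists_append (h : RuleDerives R (u ++ v) w) :
    ∃ w₁ w₂, w = w₁ ++ w₂ ∧ RuleDerives R u w₁ ∧ RuleDerives R v w₂ := by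
  induction h with
  | refl => exact ⟨u, v, rfl, .refl, .refl⟩
  | tail _ hstep ih =>
    obtain ⟨w₁, w₂, rfl, h₁, h₂⟩ := ih
    obtain ⟨r, hr, hrw⟩ := hstep
    obtain ⟨p, q, hpq, rfl⟩ := hrw.exists_parts
    rw [List.append_assoc, List.append_eq_append_iff] at hpq
    rcases hpq with ⟨s, rfl, rfl⟩ | ⟨s, rfl, hs⟩
    · refine ⟨w₁, s ++ r.output ++ q, by simp, h₁, h₂.tail ⟨r, hr, ?_⟩⟩
      simpa using ContextFreeRule.rewrites_of_exists_parts r s q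
    · cases s with
      | nil =>
        refine ⟨p, r.output ++ q, by simp, by simpa using h₁, h₂.tail ⟨r, hr, ?_⟩⟩
        rw [List.nil_append] at hs
        simpa [← hs] using ContextFreeRule.rewrites_of_exists_parts r [] q
      | cons a s =>
        simp only [List.cons_append, List.nil_append, List.cons.injEq] at hs
        obtain ⟨rfl, rfl⟩ := hs
        refine ⟨p ++ r.output ++ s, w₂, by simp, h₁.tail ⟨r, hr, ?_⟩, h₂⟩
        simpa using ContextFreeRule.rewrites_of_exists_parts r p s

lemma mem_derivedWords_append {w : List T} : w ∈ derivedWords R (α ++ β) ↔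
    ∃ x ∈ derivedWords R α, ∃ y ∈ derivedWords R β, w = x ++ y := by
  constructor
  · intro h
    obtain ⟨w₁, w₂, hw, h₁, h₂⟩ := RuleDerives.exists_append h
    obtain ⟨x, y, rfl, rfl, rfl⟩ := List.map_eq_append_iff.1 hw
    exact ⟨x, h₁, y, h₂, rfl⟩
  · rintro ⟨x, hx, y, hy, rfl⟩
    simpa [derivedWords] using RuleDerives.append hx hy

lemma eq_of_ruleDerives_terminal {x : List T} (h : RuleDerives R (x.map .terminal) w) :
    w = x.map .terminal := by
  rcases Relation.ReflTransGen.cases_head h with h | ⟨v, ⟨r, -, hrw⟩, -⟩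
  · exact h.symm
  · simpa using hrw.nonterminal_input_mem

lemma derivedWords_terminal (x : List T) :
    derivedWords R (x.map .terminal) = {x} := by
  ext w
  constructor
  · intro h
    exact List.map_injective_iff.2 (fun a b h => Symbol.terminal.inj h)
      (eq_of_ruleDerives_terminal h)
  · rintro rfl
    exact Relation.ReflTransGen.refl

lemma derivedWords_nonterminal_eq_empty (h : ∀ r ∈ R, r.input ≠ A) :
    derivedWords R [.nonterminal A] = ∅ := by
  refine Set.eq_empty_of_forall_notMem fun w hw => ?_
  rcases Relation.ReflTransGen.cases_head hw with h' | ⟨v, ⟨r, hr, hrw⟩, -⟩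
  · cases w <;> simp at h'
  · exact h r hr (by simpa using hrw.nonterminal_input_mem)

open Classical in
/-- The rules whose left-hand side is not `A`. -/
noncomputable def rulesAvoiding (R : Finset (ContextFreeRule T N)) (A : N) :
    Finset (ContextFreeRule T N) :=
  R.filter fun r => r.input ≠ A

lemma rulesAvoiding_subset : rulesAvoiding R A ⊆ R :=
  fun r hr => (by simpa [rulesAvoiding] using hr : r ∈ R ∧ r.input ≠ A).1

/-- A derivation of a terminal word either never rewrites `A`, or has a last rewriting of `A`
after which only terminal symbols surround it. -/
lemma ruleDerives_avoiding_or {w : List T} (h : RuleDerives R α (w.map .terminal)) :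
    RuleDerives (rulesAvoiding R A) α (w.map .terminal) ∨
    ∃ x z y : List T, w = x ++ z ++ y ∧
      RuleDerives R α (x.map .terminal ++ [.nonterminal A] ++ y.map .terminal) ∧
      ∃ r ∈ R, r.input = A ∧ z ∈ derivedWords (rulesAvoiding R A) r.output := by
  induction h using Relation.ReflTransGen.head_induction_on with
  | refl => exact .inl .refl
  | head hstep _ ih =>
    rcases ih with ih | ⟨x, z, y, hw, hd, hr⟩
    · obtain ⟨r, hr, hrw⟩ := hstep
      by_cases hA : r.input = A
      · obtain ⟨p, q, rfl, rfl⟩ := hrw.exists_parts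
        obtain ⟨xz, hxz, y, hy, rfl⟩ := mem_derivedWords_append.1 ih
        obtain ⟨x, hx, z, hz, rfl⟩ := mem_derivedWords_append.1 hxz
        refine .inr ⟨x, z, y, rfl, ?_, r, hr, hA, hz⟩
        rw [hA]
        exact ((RuleDerives.mono rulesAvoiding_subset hx).append_right _).append
          (RuleDerives.mono rulesAvoiding_subset hy)
      · exact .inl (ih.head ⟨r, by simp [rulesAvoiding, hr, hA], hrw⟩)
    · exact .inr ⟨x, z, y, hw, hd.head hstep, hr⟩

lemma mem_derivedWords_nonterminal {w : List T} : w ∈ derivedWords R [.nonterminal A] ↔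
    ∃ c ∈ derivedContexts R A, ∃ r ∈ {r ∈ (R : Set (ContextFreeRule T N)) | r.input = A},
      ∃ z ∈ derivedWords (rulesAvoiding R A) r.output, w = c.1 ++ z ++ c.2 := by
  constructor
  · intro h
    rcases ruleDerives_avoiding_or (A := A) h with h | ⟨x, z, y, hw, hd, r, hr, hA, hz⟩
    · have := derivedWords_nonterminal_eq_empty (R := rulesAvoiding R A) (A := A)
        (by simp [rulesAvoiding])
      exact absurd h (Set.eq_empty_iff_forall_notMem.1 this w)
    · exact ⟨(x, y), hd, r, ⟨hr, hA⟩, z, hz, hw⟩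
  · rintro ⟨⟨x, y⟩, hc, r, ⟨hr, rfl⟩, z, hz, rfl⟩
    have hz' := (RuleDerives.of_rule hr).trans (RuleDerives.mono rulesAvoiding_subset hz)
    have := RuleDerives.trans hc ((hz'.append_left _).append_right _)
    simpa [derivedWords] using this

lemma derivedContexts_mul {c d : List T × List T} (hc : c ∈ derivedContexts R A)
    (hd : d ∈ derivedContexts R A) : (c.1 ++ d.1, d.2 ++ c.2) ∈ derivedContexts R A := by
  have := RuleDerives.trans hc ((RuleDerives.append_left hd _).append_right _)
  simpa [derivedContexts] using this

open Classical in
lemma card_inputs_rulesAvoiding_lt {r : ContextFreeRule T N} (hr : r ∈ R) (hA : r.input = A) :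
    ((rulesAvoiding R A).image (·.input)).card < (R.image (·.input)).card := by
  refine Finset.card_lt_card ⟨Finset.image_subset_image rulesAvoiding_subset, fun h => ?_⟩
  have := h (Finset.mem_image_of_mem _ hr)
  simp [rulesAvoiding] at this
  obtain ⟨_, ⟨_, h₁⟩, h₂⟩ := this
  exact h₁ (h₂.trans hA)

end Grammars

section CompactClosure

open MulOpposite Pointwise

variable {G : Type*} [Group G] [TopologicalSpace G] [IsTopologicalGroup G] [CompactSpace G]
  [T2Space G]

lemma closure_mul_eq_mul_closure (S T : Set G) : closure (S * T) = closure S * closure T := by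
  have h := image_closure_of_isCompact (s := S ×ˢ T) isClosed_closure.isCompact
    (f := fun p : G × G => p.1 * p.2) (by fun_prop)
  rw [closure_prod_eq, Set.image_mul_prod, Set.image_mul_prod] at h
  exact h.symm

/-- The action of `G × Gᵐᵒᵖ` on subsets of `G` by left and right multiplication. -/
def twoSidedMul (D : Set (G × Gᵐᵒᵖ)) (S : Set G) : Set G :=
  {g | ∃ d ∈ D, ∃ x ∈ S, g = d.1 * x * d.2.unop}

lemma closure_twoSidedMul (D : Set (G × Gᵐᵒᵖ)) (S : Set G) :
    closure (twoSidedMul D S) = twoSidedMul (closure D) (closure S) := by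
  have h := image_closure_of_isCompact (s := D ×ˢ S) isClosed_closure.isCompact
    (f := fun p : (G × Gᵐᵒᵖ) × G => p.1.1 * p.2 * p.1.2.unop) (by fun_prop)
  rw [closure_prod_eq] at h
  convert h.symm using 2 <;> ext g <;>
    simp only [twoSidedMul, Set.mem_ofPred_eq, Set.mem_image, Set.mem_prod, Prod.exists] <;> grind

variable {T N : Type*} (f : FreeMonoid T →* G)

/-- A class of subsets of a compact group which contains `∅` and singletons, and is closed under
unions, products and the two-sided action of closed subgroups, contains the closure of the image of
every language derived from a finite set of context-free rules. -/
theorem closure_image_derivedWords_induction {P : Set G → Prop} (h_empty : P ∅)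
    (h_singleton : ∀ g, P {g}) (h_union : ∀ S T, P S → P T → P (S ∪ T))
    (h_mul : ∀ S T, P S → P T → P (S * T))
    (h_twoSided : ∀ (K : Subgroup (G × Gᵐᵒᵖ)) (S : Set G), IsClosed (K : Set (G × Gᵐᵒᵖ)) → P S →
      P (twoSidedMul K S))
    (R : Finset (ContextFreeRule T N)) (α : List (Symbol T N)) :
    P (closure ((fun w => f (FreeMonoid.ofList w)) '' derivedWords R α)) := by
  classical
  set F : List T → G := fun w => f (FreeMonoid.ofList w) with hF
  have hF_append : ∀ u v, F (u ++ v) = F u * F v := fun u v => by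
    simp [hF, FreeMonoid.ofList_append]
  induction hk : (R.image (·.input)).card using Nat.strong_induction_on generalizing R α with
  | _ k ih =>
  have h_nonterminal : ∀ A : N, P (closure (F '' derivedWords R [.nonterminal A])) := by
    intro A
    let C : Set (G × Gᵐᵒᵖ) := (fun c => (F c.1, op (F c.2))) '' derivedContexts R A
    let M : Submonoid (G × Gᵐᵒᵖ) :=
      { carrier := C
        one_mem' := ⟨([], []), Relation.ReflTransGen.refl, by simp [hF]⟩
        mul_mem' := by
          rintro _ _ ⟨c, hc, rfl⟩ ⟨d, hd, rfl⟩
          exact ⟨_, derivedContexts_mul hc hd, by simp [hF_append]⟩ }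
    let K : Subgroup (G × Gᵐᵒᵖ) := (Subgroup.closure C).topologicalClosure
    have hK : closure C = K := by
      have := closure_submonoidClosure_eq_closure_subgroupClosure C
      rwa [show Submonoid.closure C = M from Submonoid.closure_eq M] at this
    let I : Set (ContextFreeRule T N) := {r ∈ (R : Set (ContextFreeRule T N)) | r.input = A}
    have hI : I.Finite := R.finite_toSet.subset fun r hr => hr.1
    let S : ContextFreeRule T N → Set G := fun r => F '' derivedWords (rulesAvoiding R A) r.output
    have hS : ∀ r ∈ I, P (closure (S r)) := fun r hr =>
      ih _ (hk ▸ card_inputs_rulesAvoiding_lt hr.1 hr.2) _ _ rfl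
    have hU : P (closure (⋃ r ∈ I, S r)) := by
      rw [hI.closure_biUnion]
      clear_value I
      induction I, hI using Set.Finite.induction_on with
      | empty => simpa using h_empty
      | insert _ _ ih' =>
        rw [Set.biUnion_insert]
        exact h_union _ _ (hS _ (Set.mem_insert _ _))
          (ih' fun r hr => hS r (Set.mem_insert_of_mem _ hr))
    have : F '' derivedWords R [.nonterminal A] = twoSidedMul C (⋃ r ∈ I, S r) := by
      ext g
      constructor
      · rintro ⟨w, hw, rfl⟩
        obtain ⟨c, hc, r, hr, z, hz, rfl⟩ := mem_derivedWords_nonterminal.1 hw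
        refine ⟨_, ⟨c, hc, rfl⟩, F z, Set.mem_biUnion hr ⟨z, hz, rfl⟩, ?_⟩
        simp [hF_append, mul_assoc]
      · rintro ⟨_, ⟨c, hc, rfl⟩, x, hx, rfl⟩
        obtain ⟨r, hr, z, hz, rfl⟩ := Set.mem_iUnion₂.1 hx
        exact ⟨_, mem_derivedWords_nonterminal.2 ⟨c, hc, r, hr, z, hz, rfl⟩,
          by simp [hF_append, mul_assoc]⟩
    rw [this, closure_twoSidedMul, hK]
    exact h_twoSided K _ (Subgroup.isClosed_topologicalClosure _) hU
  clear ih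
  have h_terminal : ∀ x : List T,
      P (closure (F '' derivedWords R (x.map (Symbol.terminal (N := N))))) := fun x => by
    rw [derivedWords_terminal, Set.image_singleton, closure_singleton]
    exact h_singleton _
  induction α with
  | nil => exact h_terminal []
  | cons a α ihα =>
    have : F '' derivedWords R (a :: α) =
        F '' derivedWords R [a] * F '' derivedWords R α := by
      ext g
      constructor
      · rintro ⟨w, hw, rfl⟩
        obtain ⟨x, hx, y, hy, rfl⟩ := mem_derivedWords_append (α := [a]).1 hw
        exact ⟨_, ⟨x, hx, rfl⟩, _, ⟨y, hy, rfl⟩, (hF_append _ _).symm⟩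
      · rintro ⟨_, ⟨x, hx, rfl⟩, _, ⟨y, hy, rfl⟩, rfl⟩
        exact ⟨x ++ y, mem_derivedWords_append (α := [a]).2 ⟨x, hx, y, hy, rfl⟩, hF_append _ _⟩
    rw [this, closure_mul_eq_mul_closure]
    refine h_mul _ _ ?_ ihα
    cases a with
    | terminal t => exact h_terminal [t]
    | nonterminal A => exact h_nonterminal A

end CompactClosure

section MatrixSets

open MvPolynomial MulOpposite Pointwise

/-- The image of a product of two semialgebraic sets under a polynomial map is semialgebraic. -/
lemma IsSemialgebraic.image2 {σ τ υ : Type} [Fintype σ] [Fintype τ] [Fintype υ]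
    {S : Set (σ → ℝ)} {T : Set (τ → ℝ)} (hS : IsSemialgebraic S) (hT : IsSemialgebraic T)
    (f : υ → MvPolynomial (σ ⊕ τ) ℝ) :
    IsSemialgebraic {z | ∃ x ∈ S, ∃ y ∈ T, z = fun j => eval (Sum.elim x y) (f j)} := by
  have h := ((hS.preimage fun j => X (Sum.inl j)).inter
    (hT.preimage fun j => (X (Sum.inr j) : MvPolynomial (σ ⊕ τ) ℝ))).image f
  convert h using 1
  ext z
  constructor
  · rintro ⟨x, hx, y, hy, rfl⟩
    exact ⟨Sum.elim x y, ⟨by simpa using hx, by simpa using hy⟩, rfl⟩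
  · rintro ⟨p, ⟨hx, hy⟩, rfl⟩
    refine ⟨fun j => p (Sum.inl j), by simpa using hx,
      fun j => p (Sum.inr j), by simpa using hy, ?_⟩
    congr! 4
    ext (j | j) <;> rfl

lemma MatSemialgebraic.image2 {ι ι' ι'' : Type} [Fintype ι] [Fintype ι'] [Fintype ι'']
    {S : Set (Matrix ι ι ℝ)} {T : Set (Matrix ι' ι' ℝ)} (hS : MatSemialgebraic S)
    (hT : MatSemialgebraic T) (F : Matrix ι ι ℝ → Matrix ι' ι' ℝ → Matrix ι'' ι'' ℝ)
    (f : ι'' × ι'' → MvPolynomial ((ι × ι) ⊕ (ι' × ι')) ℝ)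
    (hf : ∀ A B i j, F A B i j =
      eval (Sum.elim (fun p => A p.1 p.2) fun p => B p.1 p.2) (f (i, j))) :
    MatSemialgebraic {C | ∃ A ∈ S, ∃ B ∈ T, C = F A B} := by
  rw [MatSemialgebraic]
  convert IsSemialgebraic.image2 hS hT f using 1
  ext z
  constructor
  · rintro ⟨A, hA, B, hB, h⟩
    refine ⟨fun p => A p.1 p.2, hA, fun p => B p.1 p.2, hB, ?_⟩
    ext ⟨i, j⟩
    rw [← hf, ← h]
    rfl
  · rintro ⟨x, hx, y, hy, rfl⟩
    refine ⟨_, hx, _, hy, ?_⟩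
    ext i j
    rw [hf]
    rfl

lemma MatSemialgebraic.union {ι : Type} [Fintype ι] {S T : Set (Matrix ι ι ℝ)}
    (hS : MatSemialgebraic S) (hT : MatSemialgebraic T) : MatSemialgebraic (S ∪ T) :=
  IsSemialgebraic.union hS hT

lemma MatSemialgebraic.mul {ι : Type} [Fintype ι] {S T : Set (Matrix ι ι ℝ)}
    (hS : MatSemialgebraic S) (hT : MatSemialgebraic T) : MatSemialgebraic (S * T) := by
  convert MatSemialgebraic.image2 hS hT (· * ·)
    (fun p => ∑ k, X (Sum.inl (p.1, k)) * X (Sum.inr (k, p.2))) (fun A B i j => by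
      simp [Matrix.mul_apply]) using 1
  ext C
  simp [Set.mem_mul, eq_comm]

lemma MatSemialgebraic.singleton {ι : Type} [Fintype ι] (A : Matrix ι ι ℝ) :
    MatSemialgebraic {A} := by
  have := IsSemialgebraic.biInter (Set.finite_univ (α := ι × ι)) fun p _ =>
    IsSemialgebraic.zero_locus (X p - C (A p.1 p.2))
  rw [MatSemialgebraic]
  convert this using 1
  ext x
  simp [sub_eq_zero, ← Matrix.ext_iff]

instance compactSpace_orthogonalGroup {ι : Type} [Fintype ι] [DecidableEq ι] :
    CompactSpace (Matrix.orthogonalGroup ι ℝ) := by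
  refine isCompact_iff_compactSpace.1 (IsCompact.of_isClosed_subset
    (isCompact_univ_pi fun _ => isCompact_univ_pi fun _ => isCompact_Icc (a := (-1 : ℝ)) (b := 1))
    isClosed_unitary fun U hU i _ j _ => ?_)
  exact abs_le.1 (entry_norm_bound_of_unitary hU i j)

/-- The block diagonal representation `(u, w) ↦ diag(u, wᵀ)` of `O(n) × O(n)ᵐᵒᵖ`. -/
def blockRepresentation {ι : Type} [Fintype ι] [DecidableEq ι] :
    Matrix.orthogonalGroup ι ℝ × (Matrix.orthogonalGroup ι ℝ)ᵐᵒᵖ →* Matrix (ι ⊕ ι) (ι ⊕ ι) ℝ where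
  toFun d := Matrix.fromBlocks d.1 0 0 (d.2.unop : Matrix ι ι ℝ)ᵀ
  map_one' := by simp
  map_mul' d e := by simp [Matrix.fromBlocks_multiply]

lemma continuous_blockRepresentation {ι : Type} [Fintype ι] [DecidableEq ι] :
    Continuous (blockRepresentation (ι := ι)) := by
  refine Continuous.matrix_fromBlocks ?_ continuous_const continuous_const ?_
  · fun_prop
  · exact Continuous.matrix_transpose (by fun_prop)

/-- The action of a closed subgroup of `O(n) × O(n)ᵐᵒᵖ` preserves semialgebraic sets. -/
lemma matSemialgebraic_twoSidedMul {ι : Type} [Fintype ι] [DecidableEq ι]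
    (K : Subgroup (Matrix.orthogonalGroup ι ℝ × (Matrix.orthogonalGroup ι ℝ)ᵐᵒᵖ))
    (hK : IsClosed (K : Set (Matrix.orthogonalGroup ι ℝ × (Matrix.orthogonalGroup ι ℝ)ᵐᵒᵖ)))
    {S : Set (Matrix.orthogonalGroup ι ℝ)}
    (hS : MatSemialgebraic ((↑) '' S : Set (Matrix ι ι ℝ))) :
    MatSemialgebraic ((↑) '' twoSidedMul (K : Set _) S : Set (Matrix ι ι ℝ)) := by
  have : CompactSpace K := isCompact_iff_compactSpace.1 hK.isCompact
  have hρ := matSemialgebraic_range (blockRepresentation.comp K.subtype)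
    (continuous_blockRepresentation.comp continuous_subtype_val)
  convert MatSemialgebraic.image2 hρ hS (fun M A => M.toBlocks₁₁ * A * M.toBlocks₂₂ᵀ)
    (fun p => ∑ l, (∑ k, X (Sum.inl (Sum.inl p.1, Sum.inl k)) * X (Sum.inr (k, l))) *
      X (Sum.inl (Sum.inr p.2, Sum.inr l))) (fun M A i j => by
        simp [Matrix.mul_apply, Matrix.toBlocks₁₁, Matrix.toBlocks₂₂]) using 1
  ext C
  constructor
  · rintro ⟨_, ⟨d, hd, x, hx, rfl⟩, rfl⟩
    exact ⟨_, ⟨⟨d, hd⟩, rfl⟩, x, ⟨x, hx, rfl⟩, by simp [blockRepresentation]⟩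
  · rintro ⟨_, ⟨⟨d, hd⟩, rfl⟩, _, ⟨x, hx, rfl⟩, rfl⟩
    exact ⟨_, ⟨d, hd, x, hx, rfl⟩, by simp [blockRepresentation]⟩

end MatrixSets

/-- For a monoid morphism `φ` from the free monoid over a finite alphabet into
the orthogonal `n×n` matrices and a context-free language `L`, the closure of `φ(L)` is
semialgebraic. -/
theorem closure_image_contextFree_semialgebraic {m n : ℕ}
    (φ : FreeMonoid (Fin m) →* Matrix (Fin n) (Fin n) ℝ)
    (hφ : ∀ u, (φ u)ᵀ * φ u = 1)
    (L : Language (Fin m)) (hL : L.IsContextFree) :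
    MatSemialgebraic (closure
      ((fun w : List (Fin m) => φ (FreeMonoid.ofList w)) '' L)) := by
  obtain ⟨g, rfl⟩ := hL
  let f : FreeMonoid (Fin m) →* Matrix.orthogonalGroup (Fin n) ℝ :=
    φ.codRestrict _ fun u => Matrix.mem_orthogonalGroup_iff' _ _ |>.2 (hφ u)
  have h := closure_image_derivedWords_induction f
    (P := fun S => MatSemialgebraic ((↑) '' S : Set (Matrix (Fin n) (Fin n) ℝ)))
    (by simpa [MatSemialgebraic] using IsSemialgebraic.empty)
    (fun g => by simpa using MatSemialgebraic.singleton (g : Matrix (Fin n) (Fin n) ℝ))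
    (fun S T hS hT => by
      rw [Set.image_union]
      exact hS.union hT)
    (fun S T hS hT => by
      have := Set.image_mul (Matrix.orthogonalGroup (Fin n) ℝ).subtype (s := S) (t := T)
      simp only [Submonoid.coe_subtype] at this
      rw [this]
      exact hS.mul hT)
    (fun K S hK hS => matSemialgebraic_twoSidedMul K hK hS)
    g.rules [.nonterminal g.initial]
  rw [image_closure_of_isCompact isClosed_closure.isCompact continuous_subtype_val.continuousOn,
    Set.image_image] at h
  exact h
end

section
/- Let α be an irrational real number with 0 < α < 1. Then there are infinitely many positive integers n for which there exists a natural number q with |α[1 + 2ℓ(n)] − q/n| < 1/n², where ℓ(n) = ⌊log₂ n⌋ and α[k] = ⌊2^k α⌋ / 2^k. -/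
/-- The truncation `α[k] = ⌊2^k α⌋ / 2^k` of the binary expansion of `α` to `k` digits. -/
noncomputable def binTrunc (α : ℝ) (k : ℕ) : ℝ := ⌊2 ^ k * α⌋ / 2 ^ k

/-- If no integer `n ∈ [M, 2M)` satisfies `|β - P / n| < 1 / n ^ 2`, then some rational of
denominator less than `M / 2` is as close to `β` as in Dirichlet's theorem for the bound `2M`. -/
theorem exists_rat_two_mul_den_lt {β : ℝ} {M : ℕ} (hM : 0 < M)
    (hbad : ∀ n : ℕ, M ≤ n → n < 2 * M → ∀ P : ℤ, 1 ≤ (n : ℝ) * |n * β - P|) :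
    ∃ r : ℚ, 2 * r.den < M ∧ |r.den * β - r.num| * (2 * M) ≤ 1 := by
  obtain ⟨r, hr, hden⟩ := Real.exists_rat_abs_sub_le_and_den_le β (n := 2 * M - 1) (by omega)
  have hq0 : (0 : ℝ) < r.den := by exact_mod_cast r.den_pos
  have hMR : (0 : ℝ) < M := by exact_mod_cast hM
  have hcast : ((2 * M - 1 : ℕ) : ℝ) + 1 = 2 * M := by
    have : 2 * M - 1 + 1 = 2 * M := by omega
    exact_mod_cast this
  have hδ : |r.den * β - r.num| * (2 * M) ≤ 1 := by
    rw [hcast, le_div_iff₀ (by positivity)] at hr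
    have h2 : (r.den : ℝ) * β - r.num = r.den * (β - r) := by
      have h3 : (r : ℝ) = r.num / r.den := Rat.cast_def r
      rw [h3]
      field_simp
    rw [h2, abs_mul, abs_of_pos hq0]
    linarith
  refine ⟨r, ?_, hδ⟩
  by_contra! hq
  obtain ⟨s, hs, hsδ⟩ : ∃ s : ℤ, (s = 1 ∨ s = -1) ∧
      (r.den * β - r.num : ℝ) = s * |r.den * β - r.num| := by
    rcases abs_choice (r.den * β - r.num : ℝ) with h | h
    · exact ⟨1, Or.inl rfl, by push_cast; linarith⟩
    · exact ⟨-1, Or.inr rfl, by push_cast; linarith⟩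
  have hb1 : M ≤ r.den → 1 ≤ (r.den : ℝ) * |r.den * β - r.num| :=
    fun h => hbad r.den h (by omega) r.num
  have hb2 : r.den < M → 1 ≤ 4 * ((r.den : ℝ) * |r.den * β - r.num|) := by
    intro h
    have h2 := hbad (2 * r.den) hq (by omega) (2 * r.num)
    push_cast at h2
    rw [show 2 * (r.den : ℝ) * β - 2 * r.num = 2 * (r.den * β - r.num) by ring, abs_mul,
      abs_of_pos (by norm_num : (0 : ℝ) < 2)] at h2
    linarith
  set δ := |r.den * β - r.num|
  have hδ0 : 0 ≤ δ := abs_nonneg _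
  rcases le_or_gt M r.den with h | h
  · have h1 := hb1 h
    have h2 : (r.den : ℝ) + 1 ≤ 2 * M := by
      have : r.den + 1 ≤ 2 * M := by omega
      exact_mod_cast this
    nlinarith
  have h4 := hb2 h
  obtain ⟨a, b, hab⟩ : IsCoprime r.num (r.den : ℤ) := by
    rw [Int.isCoprime_iff_gcd_eq_one]
    exact r.reduced
  obtain ⟨Q, P, hdet, hQ1, hQ2⟩ : ∃ Q P : ℤ, Q * r.num - r.den * P = -s ∧
      2 * (M : ℤ) - r.den ≤ Q ∧ Q < 2 * M := by
    have hqZ : (0 : ℤ) < r.den := by exact_mod_cast r.den_pos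
    have e1 := Int.emod_nonneg (-s * a - (2 * M - r.den)) hqZ.ne'
    have e2 := Int.emod_lt_of_pos (-s * a - (2 * M - r.den)) hqZ
    have e3 := Int.emod_add_mul_ediv (-s * a - (2 * M - r.den)) r.den
    set k := (-s * a - (2 * M - r.den)) / (r.den : ℤ)
    refine ⟨-s * a - r.den * k, -k * r.num + s * b, ?_, by linarith, by linarith⟩
    linear_combination (-s) * hab
  lift Q to ℕ using by omega
  have hQM : M ≤ Q := by omega
  have hb3 := hbad Q hQM (by omega) P
  have hQR : (0 : ℝ) < Q := by exact_mod_cast (by omega : 0 < Q)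
  have hQ2R : (Q : ℝ) ≤ 2 * M := by exact_mod_cast hQ2.le
  have hdetR : (Q : ℝ) * r.num - r.den * P = -s := by exact_mod_cast hdet
  have hkey : (r.den : ℝ) * |Q * β - P| = 1 - Q * δ := by
    have e : (r.den : ℝ) * (Q * β - P) = -s * (1 - Q * δ) := by
      linear_combination (Q : ℝ) * hsδ + hdetR
    have hs1 : |(-s : ℝ)| = 1 := by rcases hs with rfl | rfl <;> norm_num
    have e' := congrArg abs e
    rw [abs_mul, abs_of_pos hq0] at e'
    rw [e', abs_mul, hs1, one_mul, abs_of_nonneg]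
    nlinarith
  have h5 : (r.den : ℝ) ≤ Q * (1 - Q * δ) := by
    rw [← hkey]
    nlinarith
  have h6 : (2 * (r.den : ℝ) - Q) ^ 2 ≤ 0 := by
    nlinarith [mul_le_mul_of_nonneg_left h5 hq0.le, mul_le_mul_of_nonneg_left h4 (sq_nonneg (Q : ℝ))]
  have h7 : (Q : ℝ) = 2 * r.den := by
    have := pow_eq_zero_iff (two_ne_zero) |>.1 (le_antisymm h6 (sq_nonneg _))
    linarith
  have h8 : Q = 2 * r.den := by exact_mod_cast h7
  have h9 : (r.den : ℤ) ∣ 1 := by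
    have h10 : (r.den : ℤ) ∣ -s := ⟨2 * r.num - P, by rw [← hdet, h8]; push_cast; ring⟩
    rcases hs with rfl | rfl
    · simpa using h10
    · simpa using h10
  have h11 : r.den = 1 := by exact_mod_cast Int.eq_one_of_dvd_one (by positivity) h9
  omega

/-- Two rationals of small denominator which are close to nearby reals are equal. -/
theorem rat_eq_of_abs_den_mul_sub_num_le {β β' : ℝ} {M : ℕ} {r r' : ℚ}
    (hβ : |β' - β| * (2 * M ^ 2) ≤ 1) (hden : 2 * r.den < M)
    (hr : |r.den * β - r.num| * (2 * M) ≤ 1) (hden' : r'.den < M)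
    (hr' : |r'.den * β' - r'.num| * (4 * M) ≤ 1) : r = r' := by
  by_contra hne
  have hdet : r.num * r'.den - r'.num * r.den ≠ 0 := fun h =>
    hne (Rat.eq_iff_mul_eq_mul.2 (by linarith))
  have h1 : (1 : ℝ) ≤ |(r.num : ℝ) * r'.den - r'.num * r.den| := by
    exact_mod_cast Int.one_le_abs hdet
  have e : (r.num : ℝ) * r'.den - r'.num * r.den =
      r.den * (r'.den * β' - r'.num) - r'.den * (r.den * β - r.num)
        - r.den * r'.den * (β' - β) := by ring
  have hq : (0 : ℝ) < r.den := by exact_mod_cast r.den_pos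
  have hq' : (0 : ℝ) < r'.den := by exact_mod_cast r'.den_pos
  have hd : 2 * (r.den : ℝ) < M := by exact_mod_cast hden
  have hd' : (r'.den : ℝ) < M := by exact_mod_cast hden'
  have hM : (0 : ℝ) < M := by linarith
  have h2 : |(r.num : ℝ) * r'.den - r'.num * r.den| ≤ r.den * |r'.den * β' - r'.num|
      + r'.den * |r.den * β - r.num| + r.den * r'.den * |β' - β| := by
    rw [e]
    refine (abs_sub _ _).trans (add_le_add ((abs_sub _ _).trans (add_le_add ?_ ?_)) ?_) <;>
      simp [abs_mul]
  have a1 : r.den * |r'.den * β' - r'.num| ≤ 1 / 8 := by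
    nlinarith [abs_nonneg (r'.den * β' - r'.num)]
  have a2 : r'.den * |r.den * β - r.num| ≤ 1 / 2 := by
    nlinarith [abs_nonneg (r.den * β - r.num)]
  have a3 : r.den * r'.den * |β' - β| ≤ 1 / 4 := by
    have : (r.den : ℝ) * r'.den ≤ M ^ 2 / 2 := by nlinarith
    nlinarith [abs_nonneg (β' - β)]
  linarith

theorem binTrunc_le (α : ℝ) (k : ℕ) : binTrunc α k ≤ α := by
  rw [binTrunc, div_le_iff₀ (by positivity), mul_comm]
  exact Int.floor_le _

theorem sub_binTrunc_mul_le_one (α : ℝ) (k : ℕ) : (α - binTrunc α k) * 2 ^ k ≤ 1 := by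
  have h := (Int.lt_floor_add_one (2 ^ k * α)).le
  rw [binTrunc, sub_mul, div_mul_cancel₀ _ (by positivity)]
  linarith

theorem binTrunc_nonneg {α : ℝ} (h0 : 0 ≤ α) (k : ℕ) : 0 ≤ binTrunc α k :=
  div_nonneg (by exact_mod_cast Int.floor_nonneg.2 (by positivity)) (by positivity)

/-- For irrational `0 < α < 1`, there are infinitely many positive integers `n`
admitting a natural number `q` with `|α[1 + 2⌊log₂ n⌋] − q/n| < 1/n²`. -/
theorem infinite_good_approximations (α : ℝ) (hirr : Irrational α)
    (h0 : 0 < α) (h1 : α < 1) :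
    {n : ℕ | 0 < n ∧ ∃ q : ℕ,
      |binTrunc α (1 + 2 * Nat.log 2 n) - (q : ℝ) / n| < 1 / (n : ℝ) ^ 2}.Infinite := by
  intro hfin
  obtain ⟨L, hL⟩ := hfin.bddAbove
  have hbad : ∀ l : ℕ, L ≤ l → ∀ n : ℕ, 2 ^ l ≤ n → n < 2 * 2 ^ l → ∀ P : ℤ,
      1 ≤ (n : ℝ) * |n * binTrunc α (1 + 2 * l) - P| := by
    intro l hl n hn1 hn2 P
    by_contra! hlt
    have hlog : Nat.log 2 n = l := Nat.log_eq_of_pow_le_of_lt_pow hn1 (by rw [pow_succ]; omega)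
    have hLn : L < n := hl.trans_lt ((Nat.lt_two_pow_self).trans_le hn1)
    have hn : (1 : ℝ) ≤ n := by exact_mod_cast (by omega : 1 ≤ n)
    have hβ := binTrunc_nonneg h0.le (1 + 2 * l)
    have hP : 0 ≤ P := by
      by_contra! hP
      have : (P : ℝ) ≤ -1 := by exact_mod_cast (by omega : P ≤ -1)
      have h2 := le_abs_self ((n : ℝ) * binTrunc α (1 + 2 * l) - P)
      nlinarith [mul_nonneg (zero_le_one.trans hn) hβ]
    lift P to ℕ using hP
    refine hLn.not_ge (hL ⟨by omega, P, ?_⟩)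
    have hn0 : (0 : ℝ) < n := by linarith
    rw [hlog, lt_div_iff₀ (by positivity)]
    have e : (n : ℝ) * binTrunc α (1 + 2 * l) - P = n * (binTrunc α (1 + 2 * l) - P / n) := by
      field_simp
    push_cast at hlt
    rw [e, abs_mul, abs_of_pos hn0] at hlt
    linarith
  have hex : ∀ l : ℕ, ∃ r : ℚ, L ≤ l → 2 * r.den < 2 ^ l ∧
      |r.den * binTrunc α (1 + 2 * l) - r.num| * (2 * 2 ^ l) ≤ 1 := by
    intro l
    by_cases hl : L ≤ l
    · obtain ⟨r, hr⟩ := exists_rat_two_mul_den_lt (by positivity) (hbad l hl)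
      exact ⟨r, fun _ => by simpa using hr⟩
    · exact ⟨0, fun h => absurd h hl⟩
  choose r hr using hex
  have herr : ∀ l : ℕ, (α - binTrunc α (1 + 2 * l)) * (2 * (2 ^ l) ^ 2) ≤ 1 := by
    intro l
    have := sub_binTrunc_mul_le_one α (1 + 2 * l)
    rwa [pow_add, pow_one, pow_mul'] at this
  have hstep : ∀ l : ℕ, L ≤ l → r l = r (l + 1) := by
    intro l hl
    obtain ⟨d1, e1⟩ := hr l hl
    obtain ⟨d2, e2⟩ := hr (l + 1) (by omega)
    refine rat_eq_of_abs_den_mul_sub_num_le (M := 2 ^ l) (β := binTrunc α (1 + 2 * l))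
      (β' := binTrunc α (1 + 2 * (l + 1))) ?_ d1 (by simpa using e1) ?_ ?_
    · have a1 := herr l
      have a2 := herr (l + 1)
      have a3 := binTrunc_le α (1 + 2 * l)
      have a4 := binTrunc_le α (1 + 2 * (l + 1))
      have hp : (0 : ℝ) < 2 * (2 ^ l) ^ 2 := by positivity
      have a5 : (α - binTrunc α (1 + 2 * (l + 1))) * (2 * (2 ^ l) ^ 2) ≤ 1 := by
        rw [pow_succ 2 l] at a2
        nlinarith [mul_nonneg (sub_nonneg.2 a4) hp.le]
      push_cast
      rw [← le_div_iff₀ hp] at a1 a5 ⊢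
      exact abs_le.2 ⟨by linarith, by linarith⟩
    · rw [pow_succ] at d2
      omega
    · rw [pow_succ] at e2
      push_cast
      linarith
  have hconst : ∀ l : ℕ, L ≤ l → r l = r L := fun l hl =>
    Nat.le_induction rfl (fun m hm ih => (hstep m hm).symm.trans ih) l hl
  have hclose : ∀ l : ℕ, L ≤ l → |α - r L| ≤ (1 / 2) ^ l := by
    intro l hl
    have e1 := (hr l hl).2
    rw [hconst l hl] at e1
    have hq : (1 : ℝ) ≤ (r L).den := by exact_mod_cast (r L).den_pos
    have e2 : ((r L).den : ℝ) * binTrunc α (1 + 2 * l) - (r L).num =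
        (r L).den * (binTrunc α (1 + 2 * l) - r L) := by
      have h3 : (r L : ℝ) = (r L).num / (r L).den := Rat.cast_def _
      rw [h3]
      field_simp
    rw [e2, abs_mul, abs_of_pos (by linarith)] at e1
    have hp : (1 : ℝ) ≤ 2 ^ l := one_le_pow₀ (by norm_num)
    have a1 := herr l
    have a3 := binTrunc_le α (1 + 2 * l)
    have b1 : |binTrunc α (1 + 2 * l) - r L| * 2 ^ l ≤ 1 / 2 := by
      nlinarith [mul_nonneg (abs_nonneg (binTrunc α (1 + 2 * l) - r L)) (zero_le_one.trans hp)]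
    have b2 : |α - binTrunc α (1 + 2 * l)| * 2 ^ l ≤ 1 / 2 := by
      rw [abs_of_nonneg (sub_nonneg.2 a3)]
      nlinarith [mul_nonneg (sub_nonneg.2 a3) (zero_le_one.trans hp)]
    rw [one_div, inv_pow, ← one_div, le_div_iff₀ (by positivity)]
    nlinarith [abs_sub_le α (binTrunc α (1 + 2 * l)) (r L)]
  have hlim : |α - r L| ≤ 0 :=
    ge_of_tendsto (tendsto_pow_atTop_nhds_zero_of_lt_one (by norm_num : (0 : ℝ) ≤ 1 / 2)
      (by norm_num)) (Filter.eventually_atTop.2 ⟨L, hclose⟩)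
  exact hirr ⟨r L, (sub_eq_zero.1 (abs_nonpos_iff.1 hlim)).symm⟩
end

section
/- There exist a finite alphabet Σ, a dimension n, a monoid morphism φ : Σ* → O(n) whose values are orthogonal matrices with rational entries, and a language L ⊆ Σ* such that: (i) the complement Σ* \ L is a context-free language, and (ii) the topological closure of φ(L) in the space of n×n real matrices is not semialgebraic. -/
open Matrix

section LinearGrammar

variable {T N : Type}

/-- The words generated from a nonterminal by the linear grammar with rules `A → a B b`
for `step A a B b` and `A → a` for `final A a`, where `a` and `b` are letters or empty. -/
inductive LinearGen (step : N → Option T → N → Option T → Prop) (final : N → Option T → Prop) :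
    N → List T → Prop
  | final {A : N} {a : Option T} : final A a → LinearGen step final A a.toList
  | step {A B : N} {a b : Option T} {w : List T} : step A a B b → LinearGen step final B w →
      LinearGen step final A (a.toList ++ w ++ b.toList)

theorem linearGen_isContextFree [Finite T] [Finite N]
    (step : N → Option T → N → Option T → Prop) (final : N → Option T → Prop) (S : N) :
    Language.IsContextFree ({w | LinearGen step final S w} : Language T) := by
  classical
  let toSym : Option T → List (Symbol T N) := fun a => a.toList.map Symbol.terminal
  let R : Set (ContextFreeRule T N) :=
    (fun r : N × Option T × N × Option T =>
        (⟨r.1, toSym r.2.1 ++ [Symbol.nonterminal r.2.2.1] ++ toSym r.2.2.2⟩ :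
          ContextFreeRule T N)) '' {r | step r.1 r.2.1 r.2.2.1 r.2.2.2} ∪
      (fun r : N × Option T => (⟨r.1, toSym r.2⟩ : ContextFreeRule T N)) '' {r | final r.1 r.2}
  have hR : R.Finite := ((Set.toFinite _).image _).union ((Set.toFinite _).image _)
  let g : ContextFreeGrammar T := ⟨N, S, hR.toFinset⟩
  have hg : ∀ r, r ∈ g.rules ↔ r ∈ R := fun r => hR.mem_toFinset
  have gen_derives : ∀ A w, LinearGen step final A w →
      g.Derives [Symbol.nonterminal A] (w.map Symbol.terminal) := by
    intro A w h
    induction h with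
    | @final A a h =>
      refine ContextFreeGrammar.Produces.single
        ⟨⟨A, toSym a⟩, (hg _).2 (Or.inr ⟨(A, a), h, rfl⟩), ?_⟩
      exact ContextFreeRule.Rewrites.input_output
    | @step A B a b w h _ ih =>
      refine ContextFreeGrammar.Produces.trans_derives
        (v := toSym a ++ [Symbol.nonterminal B] ++ toSym b)
        ⟨⟨A, toSym a ++ [Symbol.nonterminal B] ++ toSym b⟩,
          (hg _).2 (Or.inl ⟨(A, a, B, b), h, rfl⟩), ?_⟩ ?_
      · exact ContextFreeRule.Rewrites.input_output
      · simpa [toSym] using (ih.append_left (toSym a)).append_right (toSym b)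
  have derives_gen : ∀ s, g.Derives [Symbol.nonterminal S] s →
      (∃ u B v, s = u.map Symbol.terminal ++ [Symbol.nonterminal B] ++ v.map Symbol.terminal ∧
        ∀ w, LinearGen step final B w → LinearGen step final S (u ++ w ++ v)) ∨
      (∃ u, s = u.map Symbol.terminal ∧ LinearGen step final S u) := by
    intro s h
    induction h with
    | refl => exact Or.inl ⟨[], S, [], by simp, by simp⟩
    | @tail s s' _ hp ih =>
      obtain ⟨r, hr, hrw⟩ := hp
      obtain ⟨p, q, rfl, rfl⟩ := hrw.exists_parts
      rcases ih with ⟨u, B, v, hs, hgen⟩ | ⟨u, hs, _⟩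
      · have key : p = u.map Symbol.terminal ∧ r.input = B ∧ q = v.map Symbol.terminal := by
          simp only [List.append_assoc, List.singleton_append] at hs
          rcases List.append_eq_append_iff.1 hs with ⟨c, h1, h2⟩ | ⟨c, h1, h2⟩
          · rcases c with _ | ⟨x, c⟩
            · simp_all
            · simp only [List.cons_append, List.cons.injEq] at h2
              have : x ∈ u.map (Symbol.terminal (N := N)) := by rw [h1]; simp
              rw [← h2.1] at this
              simp at this
          · rcases c with _ | ⟨x, c⟩
            · simp_all
            · simp only [List.cons_append, List.cons.injEq] at h2
              have : Symbol.nonterminal r.input ∈ v.map (Symbol.terminal (N := N)) := by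
                rw [h2.2]; simp
              simp at this
        obtain ⟨rfl, rfl, rfl⟩ := key
        rcases (hg r).1 hr with ⟨⟨A, a, B, b⟩, hst, rfl⟩ | ⟨⟨A, a⟩, hf, rfl⟩
        · refine Or.inl ⟨u ++ a.toList, B, b.toList ++ v, by simp [toSym], fun w hw => ?_⟩
          simpa using hgen _ (LinearGen.step hst hw)
        · exact Or.inr ⟨u ++ a.toList ++ v, by simp [toSym], hgen _ (LinearGen.final hf)⟩
      · have : Symbol.nonterminal r.input ∈ u.map (Symbol.terminal (N := N)) := by
          rw [← hs]; simp
        simp at this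
  refine ⟨g, ?_⟩
  ext w
  constructor
  · intro h
    rcases derives_gen _ h with ⟨u, B, v, hs, _⟩ | ⟨u, hs, h⟩
    · have : Symbol.nonterminal B ∈ w.map (Symbol.terminal (N := N)) := by rw [hs]; simp
      simp at this
    · have : w = u := List.map_injective_iff.2 (fun _ _ h => Symbol.terminal.inj h) hs
      exact this ▸ h
  · exact gen_derives S w

end LinearGrammar

open Filter Topology

/-- An analytic curve that meets a semialgebraic set along a sequence of parameters converging
to, but different from, `t` meets it along a nonempty open set of parameters. -/
theorem IsSemialgebraic.exists_mem_interior_preimage {σ : Type} [Fintype σ] {A : Set (σ → ℝ)}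
    (hA : IsSemialgebraic A) {γ : ℝ → σ → ℝ} (hγ : ∀ i, AnalyticOnNhd ℝ (γ · i) Set.univ)
    {t : ℝ} {θ : ℕ → ℝ} (hθ : Tendsto θ atTop (𝓝[≠] t)) (hmem : ∀ n, γ (θ n) ∈ A) :
    ∃ n, θ n ∈ interior (γ ⁻¹' A) := by
  obtain ⟨k, p, q, rfl⟩ := hA
  have han : ∀ P : MvPolynomial σ ℝ,
      AnalyticOnNhd ℝ (fun s => MvPolynomial.eval (γ s) P) Set.univ := fun P => by
    simpa [MvPolynomial.coe_aeval_eq_eval] using AnalyticOnNhd.aeval_mvPolynomial hγ P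
  simp only [Set.mem_iUnion] at hmem
  obtain ⟨i, hi⟩ : ∃ i, ∃ᶠ n in atTop, MvPolynomial.eval (γ (θ n)) (p i) = 0 ∧
      ∀ r ∈ q i, 0 < MvPolynomial.eval (γ (θ n)) r := by
    by_contra h
    simp only [not_exists, not_frequently] at h
    obtain ⟨n, hn⟩ := (eventually_all.2 h).exists
    obtain ⟨i, hi⟩ := hmem n
    exact hn i hi
  have hzero : ∀ s, MvPolynomial.eval (γ s) (p i) = 0 := fun s =>
    (han (p i)).eqOn_zero_of_preconnected_of_frequently_eq_zero isPreconnected_univ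
      (Set.mem_univ t) (hθ.frequently (hi.mono fun _ h => h.1)) (Set.mem_univ s)
  obtain ⟨n, -, hn⟩ := hi.exists
  refine ⟨n, mem_interior.2 ⟨⋂ r ∈ q i, {s | 0 < MvPolynomial.eval (γ s) r}, ?_, ?_, ?_⟩⟩
  · intro s hs
    simp only [Set.mem_iInter, Set.mem_ofPred_eq] at hs
    exact Set.mem_iUnion.2 ⟨i, hzero s, hs⟩
  · refine isOpen_biInter_finset fun r _ => isOpen_lt continuous_const ?_
    exact continuousOn_univ.1 (han r).continuousOn
  · simpa using hn

noncomputable section Rotations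

/-- The rotation of `ℝ³` by the angle `θ` about the third axis. -/
def rotZ (θ : ℝ) : Matrix (Fin 3) (Fin 3) ℝ :=
  !![Real.cos θ, -Real.sin θ, 0; Real.sin θ, Real.cos θ, 0; 0, 0, 1]

/-- The rotation of `ℝ³` by the angle `θ` about the first axis. -/
def rotX (θ : ℝ) : Matrix (Fin 3) (Fin 3) ℝ :=
  !![1, 0, 0; 0, Real.cos θ, -Real.sin θ; 0, Real.sin θ, Real.cos θ]

theorem rotZ_zero : rotZ 0 = 1 := by
  ext i j; fin_cases i <;> fin_cases j <;> simp [rotZ]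

theorem rotX_zero : rotX 0 = 1 := by
  ext i j; fin_cases i <;> fin_cases j <;> simp [rotX]

theorem rotZ_add (α β : ℝ) : rotZ (α + β) = rotZ α * rotZ β := by
  ext i j
  fin_cases i <;> fin_cases j <;>
    simp [rotZ, Matrix.mul_apply, Fin.sum_univ_three, Real.cos_add, Real.sin_add] <;> ring

theorem rotX_add (α β : ℝ) : rotX (α + β) = rotX α * rotX β := by
  ext i j
  fin_cases i <;> fin_cases j <;>
    simp [rotX, Matrix.mul_apply, Fin.sum_univ_three, Real.cos_add, Real.sin_add] <;> ring

theorem rotZ_transpose (θ : ℝ) : (rotZ θ)ᵀ = rotZ (-θ) := by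
  ext i j; fin_cases i <;> fin_cases j <;> simp [rotZ]

theorem rotX_transpose (θ : ℝ) : (rotX θ)ᵀ = rotX (-θ) := by
  ext i j; fin_cases i <;> fin_cases j <;> simp [rotX]

theorem rotZ_transpose_mul_self (θ : ℝ) : (rotZ θ)ᵀ * rotZ θ = 1 := by
  rw [rotZ_transpose, ← rotZ_add, neg_add_cancel, rotZ_zero]

theorem rotX_transpose_mul_self (θ : ℝ) : (rotX θ)ᵀ * rotX θ = 1 := by
  rw [rotX_transpose, ← rotX_add, neg_add_cancel, rotX_zero]

theorem rotZ_det (θ : ℝ) : (rotZ θ).det = 1 := by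
  simp [rotZ, Matrix.det_fin_three, ← sq]

theorem rotX_det (θ : ℝ) : (rotX θ).det = 1 := by
  simp [rotX, Matrix.det_fin_three, ← sq]

theorem rotZ_pow (θ : ℝ) (n : ℕ) : rotZ θ ^ n = rotZ (n * θ) := by
  induction n with
  | zero => simp [rotZ_zero]
  | succ n ih => rw [pow_succ, ih, ← rotZ_add]; push_cast; rw [add_one_mul]

theorem exists_eq_mul_cos_sin {a b c : ℝ} (h : a ^ 2 + b ^ 2 = c ^ 2) :
    ∃ α, a = c * Real.cos α ∧ b = c * Real.sin α := by
  rcases eq_or_ne c 0 with rfl | hc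
  · exact ⟨0, by nlinarith [sq_nonneg a, sq_nonneg b], by nlinarith [sq_nonneg a, sq_nonneg b]⟩
  · have hn : ‖(⟨a / c, b / c⟩ : ℂ)‖ = 1 := by
      rw [Complex.norm_def, Real.sqrt_eq_one, Complex.normSq_mk]
      field_simp
      linarith
    refine ⟨Complex.arg ⟨a / c, b / c⟩, ?_, ?_⟩
    · have := Complex.norm_mul_cos_arg ⟨a / c, b / c⟩
      rw [hn, one_mul] at this
      rw [this]; field_simp
    · have := Complex.norm_mul_sin_arg ⟨a / c, b / c⟩
      rw [hn, one_mul] at this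
      rw [this]; field_simp

theorem exists_eq_rotZ {h : Matrix (Fin 3) (Fin 3) ℝ} (ho : hᵀ * h = 1) (hd : h.det = 1)
    (h0 : h 0 2 = 0) (h1 : h 1 2 = 0) (h2 : h 2 2 = 1) : ∃ β, h = rotZ β := by
  have e : ∀ i j, h 0 i * h 0 j + h 1 i * h 1 j + h 2 i * h 2 j = (1 : Matrix _ _ ℝ) i j := by
    intro i j
    rw [← ho, Matrix.mul_apply, Fin.sum_univ_three]; rfl
  have e02 := e 0 2
  have e12 := e 1 2
  have e00 := e 0 0
  have e11 := e 1 1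
  have e01 := e 0 1
  simp [h0, h1, h2] at e02 e12 e00 e11 e01
  simp [Matrix.det_fin_three, h0, h1, h2, e02, e12] at hd
  simp only [e02, e12, mul_zero, add_zero] at e00 e11 e01
  have hz : (h 0 0 - h 1 1) ^ 2 + (h 0 1 + h 1 0) ^ 2 = 0 := by nlinarith
  have ha : h 0 0 - h 1 1 = 0 := by nlinarith [sq_nonneg (h 0 0 - h 1 1), sq_nonneg (h 0 1 + h 1 0)]
  have hb : h 0 1 + h 1 0 = 0 := by nlinarith [sq_nonneg (h 0 0 - h 1 1), sq_nonneg (h 0 1 + h 1 0)]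
  obtain ⟨β, hc, hs⟩ := exists_eq_mul_cos_sin (a := h 0 0) (b := h 1 0) (c := 1) (by nlinarith)
  refine ⟨β, ?_⟩
  rw [one_mul] at hc hs
  ext i j
  fin_cases i <;> fin_cases j <;> simp [rotZ, h0, h1, h2, e02, e12] <;> linarith

/-- The Euler angle decomposition of a rotation of `ℝ³`. -/
theorem exists_rotZ_mul_mul_rotZ_eq_rotX {g : Matrix (Fin 3) (Fin 3) ℝ} (ho : gᵀ * g = 1)
    (hd : g.det = 1) {θ : ℝ} (hθ : g 2 2 = Real.cos θ) :
    ∃ α β, rotZ α * g * rotZ β = rotX θ := by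
  have e : g 0 2 * g 0 2 + g 1 2 * g 1 2 + g 2 2 * g 2 2 = (1 : Matrix (Fin 3) (Fin 3) ℝ) 2 2 := by
    rw [← ho, Matrix.mul_apply, Fin.sum_univ_three]; rfl
  rw [Matrix.one_apply_eq] at e
  have hcs := Real.sin_sq_add_cos_sq θ
  obtain ⟨α, hq, hp⟩ := exists_eq_mul_cos_sin (a := g 1 2) (b := g 0 2) (c := -Real.sin θ)
    (by rw [hθ] at e; nlinarith)
  have hα := Real.sin_sq_add_cos_sq α
  have hx : rotX θ * (rotX θ)ᵀ = 1 := mul_eq_one_comm.1 (rotX_transpose_mul_self θ)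
  obtain ⟨β, hβ⟩ := exists_eq_rotZ (h := (rotX θ)ᵀ * (rotZ α * g))
    (by
      simp only [Matrix.transpose_mul, Matrix.transpose_transpose, Matrix.mul_assoc]
      rw [← Matrix.mul_assoc (rotX θ), hx, Matrix.one_mul, ← Matrix.mul_assoc (rotZ α)ᵀ,
        rotZ_transpose_mul_self, Matrix.one_mul, ho])
    (by simp [Matrix.det_mul, rotX_det, rotZ_det, hd])
    (by
      simp [rotX, rotZ, Matrix.mul_apply, Matrix.vecMul, dotProduct, Fin.sum_univ_three,
        hp, hq]; ring)
    (by
      simp [rotX, rotZ, Matrix.mul_apply, Matrix.vecMul, dotProduct, Fin.sum_univ_three,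
        hp, hq, hθ]
      linear_combination (-Real.cos θ * Real.sin θ) * hα)
    (by
      simp [rotX, rotZ, Matrix.mul_apply, Matrix.vecMul, dotProduct, Fin.sum_univ_three,
        hp, hq, hθ]
      linear_combination (Real.sin θ ^ 2) * hα + hcs)
  refine ⟨α, -β, ?_⟩
  have : rotZ α * g = rotX θ * rotZ β := by
    rw [← hβ, ← Matrix.mul_assoc, hx, Matrix.one_mul]
  rw [this, Matrix.mul_assoc, ← rotZ_add, add_neg_cancel, rotZ_zero, Matrix.mul_one]

/-- The acute angle of the `3-4-5` triangle with cosine `4/5`. -/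
def baseAngle : ℝ := Real.arccos (4 / 5)

theorem cos_baseAngle : Real.cos baseAngle = 4 / 5 :=
  Real.cos_arccos (by norm_num) (by norm_num)

theorem sin_baseAngle : Real.sin baseAngle = 3 / 5 := by
  rw [baseAngle, Real.sin_arccos, show (1 : ℝ) - (4 / 5) ^ 2 = (3 / 5) ^ 2 by norm_num]
  exact Real.sqrt_sq (by norm_num)

theorem irrational_baseAngle_div : Irrational (baseAngle / (2 * Real.pi)) := by
  rintro ⟨q, hq⟩
  have hpi := Real.pi_ne_zero
  have := niven (θ := baseAngle) ⟨2 * q, by push_cast; rw [hq]; field_simp⟩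
    ⟨4 / 5, by rw [cos_baseAngle]; norm_num⟩
  rw [cos_baseAngle] at this
  norm_num at this

theorem rotZ_mem_closure (α : ℝ) :
    rotZ α ∈ closure (Set.range fun n : ℕ => rotZ baseAngle ^ n) := by
  have : Fact (0 < 2 * Real.pi) := ⟨Real.two_pi_pos⟩
  let f : AddCircle (2 * Real.pi) → Matrix (Fin 3) (Fin 3) ℝ := fun a =>
    !![Real.Angle.cos a, -Real.Angle.sin a, 0; Real.Angle.sin a, Real.Angle.cos a, 0; 0, 0, 1]
  have hf : Continuous f := by
    have h1 : Continuous fun a : AddCircle (2 * Real.pi) => Real.Angle.cos a :=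
      Real.Angle.continuous_cos
    have h2 : Continuous fun a : AddCircle (2 * Real.pi) => Real.Angle.sin a :=
      Real.Angle.continuous_sin
    refine continuous_matrix fun i j => ?_
    fin_cases i <;> fin_cases j <;> simp [f] <;>
      first | exact h1 | exact h2 | exact h2.neg | fun_prop
  have hfc : ∀ θ : ℝ, f (θ : AddCircle (2 * Real.pi)) = rotZ θ := fun θ => by
    simp only [f, rotZ]
    rw [show Real.Angle.cos (θ : AddCircle (2 * Real.pi)) = Real.cos θ from Real.Angle.cos_coe θ,
      show Real.Angle.sin (θ : AddCircle (2 * Real.pi)) = Real.sin θ from Real.Angle.sin_coe θ]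
  have hd : DenseRange (fun n : ℕ => n • (baseAngle : AddCircle (2 * Real.pi))) :=
    denseRange_zsmul_iff_nsmul.1 (AddCircle.denseRange_zsmul_coe_iff.2 irrational_baseAngle_div)
  rw [← hfc]
  refine closure_mono ?_ (image_closure_subset_closure_image hf ⟨_, hd (α : AddCircle _), rfl⟩)
  rintro _ ⟨_, ⟨n, rfl⟩, rfl⟩
  refine ⟨n, ?_⟩
  change rotZ baseAngle ^ n = _
  rw [rotZ_pow, ← nsmul_eq_mul, ← hfc, AddCircle.coe_nsmul]

/-- A sequence of rotations converging to the identity, in which each term is a product of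
conjugates of the base rotations. -/
def conjSeq : ℕ → Matrix (Fin 3) (Fin 3) ℝ
  | 0 => rotX baseAngle
  | n + 1 => conjSeq n * rotZ baseAngle * (conjSeq n)ᵀ

theorem conjSeq_orthogonal (n : ℕ) : (conjSeq n)ᵀ * conjSeq n = 1 := by
  induction n with
  | zero => exact rotX_transpose_mul_self _
  | succ n ih =>
    have ih' := mul_eq_one_comm.1 ih
    simp only [conjSeq, Matrix.transpose_mul, Matrix.transpose_transpose]
    calc _ = conjSeq n * ((rotZ baseAngle)ᵀ * ((conjSeq n)ᵀ * conjSeq n) * rotZ baseAngle)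
          * (conjSeq n)ᵀ := by simp only [Matrix.mul_assoc]
      _ = 1 := by rw [ih, Matrix.mul_one, rotZ_transpose_mul_self, Matrix.mul_one, ih']

theorem conjSeq_det (n : ℕ) : (conjSeq n).det = 1 := by
  induction n with
  | zero => exact rotX_det _
  | succ n ih => simp [conjSeq, Matrix.det_mul, rotZ_det, ih]

theorem one_sub_conjSeq_succ (n : ℕ) : 1 - conjSeq (n + 1) 2 2 =
    (1 - conjSeq n 2 2) * (1 + conjSeq n 2 2) / 5 := by
  have e : conjSeq n 2 0 * conjSeq n 2 0 + conjSeq n 2 1 * conjSeq n 2 1 +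
      conjSeq n 2 2 * conjSeq n 2 2 = (1 : Matrix (Fin 3) (Fin 3) ℝ) 2 2 := by
    rw [← mul_eq_one_comm.1 (conjSeq_orthogonal n), Matrix.mul_apply, Fin.sum_univ_three]; rfl
  rw [Matrix.one_apply_eq] at e
  simp [conjSeq, rotZ, Matrix.mul_apply, Fin.sum_univ_three, cos_baseAngle, sin_baseAngle]
  linear_combination (-4 / 5) * e

theorem one_sub_conjSeq_bounds (n : ℕ) :
    0 < 1 - conjSeq n 2 2 ∧ 1 - conjSeq n 2 2 ≤ (2 / 5) ^ n / 5 := by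
  induction n with
  | zero => simp [conjSeq, rotX, cos_baseAngle]; norm_num
  | succ n ih =>
    obtain ⟨h1, h2⟩ := ih
    have h3 : ((2 : ℝ) / 5) ^ n ≤ 1 := pow_le_one₀ (by norm_num) (by norm_num)
    rw [one_sub_conjSeq_succ, pow_succ]
    constructor <;> nlinarith

theorem tendsto_conjSeq : Tendsto (fun n => conjSeq n 2 2) atTop (𝓝 1) := by
  have h : Tendsto (fun n => 1 - conjSeq n 2 2) atTop (𝓝 0) := by
    refine squeeze_zero (fun n => (one_sub_conjSeq_bounds n).1.le)
      (fun n => (one_sub_conjSeq_bounds n).2) ?_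
    simpa using (tendsto_pow_atTop_nhds_zero_of_lt_one (r := (2 / 5 : ℝ)) (by norm_num)
      (by norm_num)).div_const 5
  simpa using h.const_sub 1

theorem conjSeq_mem_Ioo (n : ℕ) : conjSeq n 2 2 ∈ Set.Ioo 0 1 := by
  obtain ⟨h1, h2⟩ := one_sub_conjSeq_bounds n
  have h3 : ((2 : ℝ) / 5) ^ n ≤ 1 := pow_le_one₀ (by norm_num) (by norm_num)
  constructor <;> linarith

theorem rotZ_mul_conjSeq_mul_rotZ_mem_closure {A : Set (Matrix (Fin 3) (Fin 3) ℝ)} {n : ℕ}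
    (h : ∀ a b, rotZ baseAngle ^ a * conjSeq n * rotZ baseAngle ^ (b + 1) ∈ A) (α β : ℝ) :
    rotZ α * conjSeq n * rotZ β ∈ closure A := by
  have h1 := rotZ_mem_closure α
  have h2 := rotZ_mem_closure (β - baseAngle)
  have hc : Continuous fun m : Matrix (Fin 3) (Fin 3) ℝ × Matrix (Fin 3) (Fin 3) ℝ =>
      m.1 * conjSeq n * (m.2 * rotZ baseAngle) := by fun_prop
  have := image_closure_subset_closure_image hc
    (Set.mem_image_of_mem _ ((closure_prod_eq (s := Set.range fun n : ℕ => rotZ baseAngle ^ n)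
      (t := Set.range fun n : ℕ => rotZ baseAngle ^ n)).symm ▸ Set.mk_mem_prod h1 h2))
  simp only [← rotZ_add, sub_add_cancel] at this
  refine closure_mono ?_ this
  rintro _ ⟨⟨_, _⟩, ⟨⟨a, rfl⟩, ⟨b, rfl⟩⟩, rfl⟩
  simpa [pow_succ] using h a b

theorem rotZ_pow_mul_mul_rotZ_pow_apply (g : Matrix (Fin 3) (Fin 3) ℝ) (a b : ℕ) :
    (rotZ baseAngle ^ a * g * rotZ baseAngle ^ b) 2 2 = g 2 2 := by
  simp only [rotZ_pow]
  simp [rotZ, Matrix.mul_apply, Matrix.vecMul, dotProduct, Fin.sum_univ_three]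

theorem closure_conjSeq_not_matSemialgebraic {A : Set (Matrix (Fin 3) (Fin 3) ℝ)}
    (hsub : ∀ g ∈ A, ∃ n a b, g = rotZ baseAngle ^ a * conjSeq n * rotZ baseAngle ^ b)
    (hmem : ∀ n a b, rotZ baseAngle ^ a * conjSeq n * rotZ baseAngle ^ (b + 1) ∈ A) :
    ¬ MatSemialgebraic (closure A) := by
  intro hsa
  let S : Set ℝ := insert 1 (Set.range fun n => conjSeq n 2 2)
  have hS : S.Countable := (Set.countable_range _).insert _
  have hcl : ∀ g ∈ closure A, g 2 2 ∈ S := by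
    have hclosed : IsClosed {g : Matrix (Fin 3) (Fin 3) ℝ | g 2 2 ∈ S} :=
      tendsto_conjSeq.isCompact_insert_range.isClosed.preimage
        (continuous_id.matrix_elem 2 2)
    refine fun g hg => closure_minimal ?_ hclosed hg
    intro g hg
    obtain ⟨n, a, b, rfl⟩ := hsub g hg
    exact Or.inr ⟨n, (rotZ_pow_mul_mul_rotZ_pow_apply _ a b).symm⟩
  let θ : ℕ → ℝ := fun n => Real.arccos (conjSeq n 2 2)
  have hcos : ∀ n, Real.cos (θ n) = conjSeq n 2 2 := fun n =>
    Real.cos_arccos (by linarith [(conjSeq_mem_Ioo n).1]) (conjSeq_mem_Ioo n).2.le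
  have hθ : ∀ n, θ n ∈ Set.Ioo 0 Real.pi := fun n =>
    ⟨Real.arccos_pos.2 (conjSeq_mem_Ioo n).2,
      (Real.arccos_lt_pi_div_two.2 (conjSeq_mem_Ioo n).1).trans (by linarith [Real.pi_pos])⟩
  let γ : ℝ → Fin 3 × Fin 3 → ℝ := fun s ij => rotX s ij.1 ij.2
  have hγ : ∀ ij, AnalyticOnNhd ℝ (γ · ij) Set.univ := by
    have h1 : AnalyticOnNhd ℝ Real.cos Set.univ := fun x _ => Real.analyticAt_cos
    have h2 : AnalyticOnNhd ℝ Real.sin Set.univ := fun x _ => Real.analyticAt_sin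
    rintro ⟨i, j⟩
    fin_cases i <;> fin_cases j <;>
      simp [γ, rotX] <;>
      first | exact analyticOnNhd_const | exact h1 | exact h2 | exact h2.neg
  have hlim : Tendsto θ atTop (𝓝[≠] 0) := by
    refine tendsto_nhdsWithin_iff.2 ⟨?_, .of_forall fun n => (hθ n).1.ne'⟩
    simpa [θ, Function.comp_def] using
      (Real.continuous_arccos.tendsto 1).comp tendsto_conjSeq
  have hof : ∀ s, (Matrix.of fun i j => γ s (i, j)) = rotX s := fun s => rfl
  obtain ⟨n, hn⟩ := hsa.exists_mem_interior_preimage hγ hlim (fun n => by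
    rw [Set.mem_ofPred_eq, hof]
    obtain ⟨α, β, h⟩ := exists_rotZ_mul_mul_rotZ_eq_rotX (conjSeq_orthogonal n) (conjSeq_det n)
      (hcos n).symm
    rw [← h]
    exact rotZ_mul_conjSeq_mul_rotZ_mem_closure (hmem n) α β)
  let U : Set ℝ := interior (γ ⁻¹' {x | (Matrix.of fun i j => x (i, j)) ∈ closure A}) ∩
    Set.Ioo 0 Real.pi
  have hU : IsOpen U := isOpen_interior.inter isOpen_Ioo
  have hUc : U.Countable := by
    refine Set.MapsTo.countable_of_injOn (f := Real.cos) (t := S) ?_ ?_ hS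
    · intro s hs
      have : rotX s ∈ closure A := interior_subset (s := γ ⁻¹' _) hs.1
      have := hcl _ this
      simpa [rotX] using this
    · exact Real.injOn_cos.mono (Set.inter_subset_right.trans Set.Ioo_subset_Icc_self)
  have := hUc.dense_compl ℝ
  obtain ⟨s, hs, hs'⟩ := this.inter_open_nonempty U hU ⟨θ n, hn, hθ n⟩
  exact hs' hs

end Rotations

section Folding

/-- The transformation of letters that relates the entries `k` and `2 * k` of the paperfolding
word. -/
def doubledLetter : Fin 7 → Fin 7 := ![0, 2, 2, 5, 6, 5, 6]

/-- The paperfolding word, indexed from `1`, over the letters `3` and `4` in odd positions and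
`5` and `6` in even positions, with the letters `1` and `2` instead of `3` and `5` in the
positions that are powers of two. -/
def foldLetter (k : ℕ) : Fin 7 :=
  if k % 2 = 1 then (if k = 1 then 1 else if k % 4 = 1 then 3 else 4)
  else if k = 0 then 0 else doubledLetter (foldLetter (k / 2))
termination_by k
decreasing_by omega

theorem foldLetter_one : foldLetter 1 = 1 := by rw [foldLetter]; simp

theorem foldLetter_of_mod_four_eq_one {k : ℕ} (h : k % 4 = 1) (hk : k ≠ 1) :
    foldLetter k = 3 := by
  rw [foldLetter, if_pos (by omega), if_neg hk, if_pos h]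

theorem foldLetter_of_mod_four_eq_three {k : ℕ} (h : k % 4 = 3) : foldLetter k = 4 := by
  rw [foldLetter, if_pos (by omega), if_neg (by omega), if_neg (by omega)]

theorem foldLetter_two_mul {k : ℕ} (hk : k ≠ 0) :
    foldLetter (2 * k) = doubledLetter (foldLetter k) := by
  rw [foldLetter, if_neg (by omega), if_neg (by omega), Nat.mul_div_cancel_left _ two_pos]

theorem foldLetter_cases (k : ℕ) (hk : k ≠ 0) : k = 1 ∨ (k % 4 = 1 ∧ k ≠ 1) ∨ k % 4 = 3 ∨
    ∃ m < k, m ≠ 0 ∧ k = 2 * m := by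
  rcases Nat.even_or_odd' k with ⟨m, rfl | rfl⟩
  · exact Or.inr (Or.inr (Or.inr ⟨m, by omega, by omega, rfl⟩))
  · omega

theorem foldLetter_two_pow (n : ℕ) : foldLetter (2 ^ (n + 1)) = 2 := by
  induction n with
  | zero => rw [zero_add, pow_one, ← mul_one 2, foldLetter_two_mul one_ne_zero, foldLetter_one]; rfl
  | succ n ih => rw [pow_succ', foldLetter_two_mul (by positivity), ih]; rfl

theorem foldLetter_ne_zero {k : ℕ} (hk : k ≠ 0) : foldLetter k ≠ 0 := by
  induction k using Nat.strong_induction_on with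
  | _ k ih =>
    rcases foldLetter_cases k hk with rfl | ⟨h, h'⟩ | h | ⟨m, hm, hm0, rfl⟩
    · rw [foldLetter_one]; decide
    · rw [foldLetter_of_mod_four_eq_one h h']; decide
    · rw [foldLetter_of_mod_four_eq_three h]; decide
    · rw [foldLetter_two_mul hm0]
      have key : ∀ e, e ≠ 0 → doubledLetter e ≠ 0 := by decide
      exact key _ (ih m hm hm0)

theorem eq_two_pow_of_foldLetter {k : ℕ} (hk : k ≠ 0) (h : foldLetter k = 1 ∨ foldLetter k = 2) :
    ∃ n, k = 2 ^ n := by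
  induction k using Nat.strong_induction_on with
  | _ k ih =>
    rcases foldLetter_cases k hk with rfl | ⟨h1, h'⟩ | h1 | ⟨m, hm, hm0, rfl⟩
    · exact ⟨0, rfl⟩
    · rw [foldLetter_of_mod_four_eq_one h1 h'] at h; exact absurd h (by decide)
    · rw [foldLetter_of_mod_four_eq_three h1] at h; exact absurd h (by decide)
    · rw [foldLetter_two_mul hm0] at h
      have key : ∀ e, doubledLetter e = 1 ∨ doubledLetter e = 2 → e = 1 ∨ e = 2 := by decide
      obtain ⟨n, rfl⟩ := ih m hm hm0 (key _ h)
      exact ⟨n + 1, by rw [pow_succ']⟩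

/-- Pairs of letters that stand for inverse rotations. -/
def InverseLetters (e f : Fin 7) : Prop :=
  (e = 1 ∨ e = 3) ∧ f = 4 ∨ e = 4 ∧ f = 3 ∨ (e = 2 ∨ e = 5) ∧ f = 6 ∨ e = 6 ∧ f = 5

theorem InverseLetters.doubledLetter {e f : Fin 7} (h : InverseLetters e f) :
    InverseLetters (doubledLetter e) (doubledLetter f) := by
  unfold InverseLetters at *
  revert e f
  decide

theorem inverseLetters_foldLetter {n a b : ℕ} (ha : 0 < a) (hab : a < b) (h : a + b = 2 ^ n) :
    InverseLetters (foldLetter a) (foldLetter b) := by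
  induction n generalizing a b with
  | zero => rw [pow_zero] at h; omega
  | succ n ih =>
    rw [pow_succ'] at h
    rcases Nat.even_or_odd' a with ⟨a', rfl | ha'⟩
    · obtain ⟨b', rfl⟩ : ∃ b', b = 2 * b' := ⟨b / 2, by omega⟩
      rw [foldLetter_two_mul (by omega), foldLetter_two_mul (by omega)]
      exact (ih (by omega) (by omega) (by omega)).doubledLetter
    · rcases n with _ | n
      · rw [pow_zero] at h; omega
      rw [pow_succ'] at h
      rcases foldLetter_cases a (by omega) with rfl | ⟨h1, h2⟩ | h1 | ⟨m, _, _, rfl⟩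
      · rw [foldLetter_one, foldLetter_of_mod_four_eq_three (by omega)]
        simp [InverseLetters]
      · rw [foldLetter_of_mod_four_eq_one h1 h2, foldLetter_of_mod_four_eq_three (by omega)]
        simp [InverseLetters]
      · rw [foldLetter_of_mod_four_eq_three h1,
          foldLetter_of_mod_four_eq_one (by omega) (by omega)]
        simp [InverseLetters]
      · omega

/-- The letters allowed in a position `≥ 2` with residue `r` modulo `4`. -/
def AllowedLetter (r : ZMod 4) (a : Fin 7) : Prop :=
  (r = 1 ∧ a = 3) ∨ (r = 3 ∧ a = 4) ∨ ((r = 0 ∨ r = 2) ∧ (a = 2 ∨ a = 5 ∨ a = 6))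

theorem natCast_zmod_four (k : ℕ) : (k : ZMod 4) = (k % 4 : ℕ) := (ZMod.natCast_mod k 4).symm

theorem AllowedLetter.ne_zero {r : ZMod 4} {a : Fin 7} (h : AllowedLetter r a) : a ≠ 0 := by
  unfold AllowedLetter at h
  rintro rfl
  simp at h

theorem allowedLetter_foldLetter {k : ℕ} (hk : 2 ≤ k) : AllowedLetter k (foldLetter k) := by
  induction k using Nat.strong_induction_on with
  | _ k ih =>
    rcases foldLetter_cases k (by omega) with rfl | ⟨h, h'⟩ | h | ⟨m, hm, hm0, rfl⟩
    · omega
    · rw [foldLetter_of_mod_four_eq_one h h', natCast_zmod_four, h]; exact Or.inl ⟨rfl, rfl⟩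
    · rw [foldLetter_of_mod_four_eq_three h, natCast_zmod_four, h]
      exact Or.inr (Or.inl ⟨rfl, rfl⟩)
    · rw [foldLetter_two_mul hm0]
      refine Or.inr (Or.inr ⟨?_, ?_⟩)
      · have : (2 * m) % 4 = 0 ∨ (2 * m) % 4 = 2 := by omega
        rw [natCast_zmod_four]
        rcases this with h | h <;> rw [h] <;> decide
      · have key : ∀ e, e ≠ 0 →
            doubledLetter e = 2 ∨ doubledLetter e = 5 ∨ doubledLetter e = 6 := by decide
        exact key _ (foldLetter_ne_zero hm0)

theorem AllowedLetter.eq_foldLetter {k : ℕ} (hk : 2 ≤ k) (hodd : k % 2 = 1) {a : Fin 7}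
    (h : AllowedLetter k a) : a = foldLetter k := by
  rw [natCast_zmod_four] at h
  have : k % 4 = 1 ∨ k % 4 = 3 := by omega
  rcases this with h1 | h1
  · rw [foldLetter_of_mod_four_eq_one h1 (by omega)]
    rw [h1] at h
    unfold AllowedLetter at h
    revert h a; decide
  · rw [foldLetter_of_mod_four_eq_three h1]
    rw [h1] at h
    unfold AllowedLetter at h
    revert h a; decide

/-- The states of an automaton that checks the letters in odd positions. -/
inductive FoldState
  | pre
  | core (r : ZMod 4) (l : Bool)
  | post
  | dead

open Classical in
/-- The transitions of the automaton: a word `0ᵃ p 0ᵇ` is read such that `p` starts with `1`,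
has allowed letters after that, and ends with `2`. -/
noncomputable def FoldState.next : FoldState → Fin 7 → FoldState
  | pre, a => if a = 0 then pre else if a = 1 then core 2 false else dead
  | core r l, a => if a = 0 then (if l then post else dead)
      else if AllowedLetter r a then core (r + 1) (decide (a = 2)) else dead
  | post, a => if a = 0 then post else dead
  | dead, _ => dead

/-- The accepting states of the automaton. -/
def FoldState.Accepting : FoldState → Prop
  | pre => False
  | core _ l => l = true
  | post => True
  | dead => False

/-- Nonterminals of a linear grammar for the words that are not of the form `0ᵃ p 0ᵇ`, where `p`
is a prefix of the paperfolding word whose length is a power of two. -/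
inductive FoldNT
  | state (q : FoldState)
  | mismatch
  | middle (e : Fin 7)

instance : Finite FoldState := by
  let f : Option (Option (Option (ZMod 4 × Bool))) → FoldState := fun
    | none => .pre
    | some none => .post
    | some (some none) => .dead
    | some (some (some (r, l))) => .core r l
  refine Finite.of_surjective f fun q => ?_
  cases q with
  | pre => exact ⟨none, rfl⟩
  | core r l => exact ⟨some (some (some (r, l))), rfl⟩
  | post => exact ⟨some none, rfl⟩
  | dead => exact ⟨some (some none), rfl⟩

instance : Finite FoldNT := by
  let f : Option (FoldState ⊕ Fin 7) → FoldNT := fun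
    | none => .mismatch
    | some (.inl q) => .state q
    | some (.inr e) => .middle e
  refine Finite.of_surjective f fun q => ?_
  cases q with
  | state q => exact ⟨some (.inl q), rfl⟩
  | mismatch => exact ⟨none, rfl⟩
  | middle e => exact ⟨some (.inr e), rfl⟩

/-- The rules of the grammar that rewrite a nonterminal to a word with a nonterminal. -/
inductive FoldStep : FoldNT → Option (Fin 7) → FoldNT → Option (Fin 7) → Prop
  | read (q : FoldState) (a : Fin 7) : FoldStep (.state q) (some a) (.state (q.next a)) none
  | guess : FoldStep (.state .pre) none .mismatch none
  | skip (a : Fin 7) : FoldStep .mismatch none .mismatch (some a)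
  | mismatch (e f : Fin 7) : e ≠ 0 → f ≠ 0 → f ≠ doubledLetter e →
      FoldStep .mismatch none (.middle e) (some f)
  | grow (e a b : Fin 7) : a ≠ 0 → FoldStep (.middle e) (some a) (.middle e) (some b)

/-- The terminating rules of the grammar. -/
inductive FoldFinal : FoldNT → Option (Fin 7) → Prop
  | reject (q : FoldState) : ¬ q.Accepting → FoldFinal (.state q) none
  | middle (e : Fin 7) : FoldFinal (.middle e) (some e)

/-- The word violates the relation between entries `k` and `2 * k` of the paperfolding word. -/
def HasMismatch (w : List (Fin 7)) : Prop :=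
  ∃ u e v f y, w = u ++ e :: (v ++ f :: y) ∧ u.length = v.length ∧ 0 ∉ u ∧
    e ≠ 0 ∧ f ≠ 0 ∧ f ≠ doubledLetter e

theorem hasMismatch_iff {w : List (Fin 7)} : HasMismatch w ↔ ∃ i e f, w[i]? = some e ∧
    w[2 * i + 1]? = some f ∧ 0 ∉ w.take i ∧ e ≠ 0 ∧ f ≠ 0 ∧ f ≠ doubledLetter e := by
  constructor
  · rintro ⟨u, e, v, f, y, rfl, hl, h⟩
    refine ⟨u.length, e, f, by simp, ?_, by simpa using h⟩
    rw [List.getElem?_append_right (by omega),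
      show 2 * u.length + 1 - u.length = u.length + 1 by omega, List.getElem?_cons_succ,
      List.getElem?_append_right (by omega)]
    simp [hl]
  · rintro ⟨i, e, f, he, hf, h⟩
    obtain ⟨hi, rfl⟩ := List.getElem?_eq_some_iff.1 he
    obtain ⟨hj, rfl⟩ := List.getElem?_eq_some_iff.1 hf
    refine ⟨w.take i, w[i], (w.drop (i + 1)).take i, w[2 * i + 1], w.drop (2 * i + 2), ?_, ?_, h⟩
    · have h2 : w.drop (2 * i + 1) = w[2 * i + 1] :: w.drop (2 * i + 2) :=
        List.drop_eq_getElem_cons hj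
      have h3 : (w.drop (i + 1)).drop i = w.drop (2 * i + 1) := by
        rw [List.drop_drop]; congr 1; omega
      rw [← h2, ← h3, List.take_append_drop, ← List.drop_eq_getElem_cons hi,
        List.take_append_drop]
    · simp; omega

/-- A language whose words are, up to padding by the letter `0`, the prefixes of the paperfolding
word whose lengths are powers of two. -/
def foldLanguage : Language (Fin 7) :=
  ({w | LinearGen FoldStep FoldFinal (.state .pre) w} : Set (List (Fin 7)))ᶜ

theorem linearGen_state {q : FoldState} {w : List (Fin 7)}
    (h : ¬ (w.foldl FoldState.next q).Accepting) :
    LinearGen FoldStep FoldFinal (.state q) w := by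
  induction w generalizing q with
  | nil => exact LinearGen.final (a := none) (FoldFinal.reject q h)
  | cons a w ih =>
    simpa using LinearGen.step (FoldStep.read q a) (ih h)

theorem linearGen_middle {e : Fin 7} {u v : List (Fin 7)} (hl : u.length = v.length) (hu : 0 ∉ u) :
    LinearGen FoldStep FoldFinal (.middle e) (u ++ e :: v) := by
  induction u generalizing v with
  | nil =>
    obtain rfl : v = [] := List.length_eq_zero_iff.1 hl.symm
    exact LinearGen.final (a := some e) (FoldFinal.middle e)
  | cons a u ih =>
    rcases List.eq_nil_or_concat v with rfl | ⟨v, b, rfl⟩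
    · simp at hl
    · simp only [List.mem_cons, not_or] at hu
      simpa using LinearGen.step (FoldStep.grow e a b (Ne.symm hu.1))
        (ih (v := v) (by simpa using hl) hu.2)

theorem HasMismatch.linearGen {w : List (Fin 7)} (h : HasMismatch w) :
    LinearGen FoldStep FoldFinal .mismatch w := by
  obtain ⟨u, e, v, f, y, rfl, hl, hu, he, hf, hef⟩ := h
  induction y using List.reverseRecOn with
  | nil => simpa using LinearGen.step (FoldStep.mismatch e f he hf hef) (linearGen_middle hl hu)
  | append_singleton y a ih => simpa using LinearGen.step (FoldStep.skip a) ih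

theorem FoldState.next_eq_pre {q : FoldState} {a : Fin 7} (h : q.next a = .pre) :
    q = .pre ∧ a = 0 := by
  cases q <;> simp only [FoldState.next] at h <;> (try split_ifs at h) <;> simp_all

theorem linearGen_imp {A : FoldNT} {w : List (Fin 7)} (h : LinearGen FoldStep FoldFinal A w) :
    match A with
    | .state q => ¬ (w.foldl FoldState.next q).Accepting ∨
        q = .pre ∧ ∃ a w', w = List.replicate a 0 ++ w' ∧ HasMismatch w'
    | .mismatch => HasMismatch w
    | .middle e => ∃ u v, w = u ++ e :: v ∧ u.length = v.length ∧ 0 ∉ u := by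
  induction h with
  | final h =>
    cases h with
    | reject q h => exact Or.inl h
    | middle e => exact ⟨[], [], by simp⟩
  | step h _ ih =>
    cases h with
    | read q a =>
      rcases ih with ih | ⟨hq, k, w', rfl, hw'⟩
      · exact Or.inl (by simpa using ih)
      · obtain ⟨rfl, rfl⟩ := FoldState.next_eq_pre hq
        exact Or.inr ⟨rfl, k + 1, w', by simp [List.replicate_succ], hw'⟩
    | guess => exact Or.inr ⟨rfl, 0, _, by simp, ih⟩
    | skip a =>
      obtain ⟨u, e, v, f, y, rfl, hl⟩ := ih
      exact ⟨u, e, v, f, y ++ [a], by simp, hl⟩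
    | mismatch e f he hf hef =>
      obtain ⟨u, v, rfl, hl, hu⟩ := ih
      exact ⟨u, e, v, f, [], by simp, hl, hu, he, hf, hef⟩
    | grow e a b ha =>
      obtain ⟨u, v, rfl, hl, hu⟩ := ih
      exact ⟨a :: u, v ++ [b], by simp, by simp [hl], by simp [hu, Ne.symm ha]⟩

theorem mem_foldLanguage {w : List (Fin 7)} : w ∈ foldLanguage ↔
    (w.foldl FoldState.next .pre).Accepting ∧
      ∀ a w', w = List.replicate a 0 ++ w' → ¬ HasMismatch w' := by
  constructor
  · intro hw
    refine ⟨not_not.1 fun h => hw (linearGen_state h), fun a w' hww' hm => hw ?_⟩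
    subst hww'
    clear hw
    change LinearGen FoldStep FoldFinal _ _
    induction a with
    | zero => simpa using LinearGen.step FoldStep.guess hm.linearGen
    | succ a ih =>
      have := LinearGen.step (FoldStep.read .pre 0) (by simpa [FoldState.next] using ih)
      simpa [List.replicate_succ] using this
  · rintro ⟨h1, h2⟩ hw
    rcases linearGen_imp hw with h | ⟨-, a, w', h, hm⟩
    · exact h h1
    · exact h2 a w' h hm

theorem foldl_dead (w : List (Fin 7)) : w.foldl FoldState.next .dead = .dead := by
  induction w with
  | nil => rfl
  | cons a w ih => exact ih

theorem eq_replicate_of_post {w : List (Fin 7)}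
    (h : (w.foldl FoldState.next .post).Accepting) : w = List.replicate w.length 0 := by
  induction w with
  | nil => rfl
  | cons a w ih =>
    rw [List.foldl_cons, FoldState.next] at h
    split_ifs at h with ha
    · rw [List.length_cons, List.replicate_succ, ← ih h, ha]
    · rw [foldl_dead] at h; exact h.elim

theorem exists_of_core {w : List (Fin 7)} {r : ZMod 4} {l : Bool}
    (h : (w.foldl FoldState.next (.core r l)).Accepting) :
    ∃ v b, w = v ++ List.replicate b 0 ∧
      (∀ (i : ℕ) (a : Fin 7), v[i]? = some a → AllowedLetter (r + (i : ZMod 4)) a) ∧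
      (v.getLast? = some 2 ∨ v = [] ∧ l = true) := by
  induction w generalizing r l with
  | nil => exact ⟨[], 0, by simp, by simp, Or.inr ⟨rfl, h⟩⟩
  | cons a w ih =>
    rw [List.foldl_cons, FoldState.next] at h
    split_ifs at h with ha hl hr
    · refine ⟨[], w.length + 1, ?_, by simp, Or.inr ⟨rfl, hl⟩⟩
      rw [List.replicate_succ, ← eq_replicate_of_post h, ha, List.nil_append]
    · rw [foldl_dead] at h; exact h.elim
    · obtain ⟨v, b, rfl, hv, hlast⟩ := ih h
      refine ⟨a :: v, b, by simp, ?_, Or.inl ?_⟩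
      · rintro (_ | i) c hc
        · simp at hc; subst hc; simpa using hr
        · rw [List.getElem?_cons_succ] at hc
          have := hv i c hc
          push_cast
          rwa [add_comm (i : ZMod 4), ← add_assoc]
      · rcases hlast with hlast | ⟨rfl, ha2⟩
        · rw [List.getLast?_cons, hlast]; rfl
        · simpa using ha2
    · rw [foldl_dead] at h; exact h.elim

theorem exists_of_pre {w : List (Fin 7)} (h : (w.foldl FoldState.next .pre).Accepting) :
    ∃ a v b, w = List.replicate a 0 ++ (1 :: v ++ List.replicate b 0) ∧
      (∀ (i : ℕ) (a : Fin 7), v[i]? = some a → AllowedLetter (2 + (i : ZMod 4)) a) ∧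
      v.getLast? = some 2 := by
  induction w with
  | nil => exact h.elim
  | cons a w ih =>
    rw [List.foldl_cons, FoldState.next] at h
    split_ifs at h with ha hl
    · obtain ⟨k, v, b, rfl, hv⟩ := ih h
      exact ⟨k + 1, v, b, by simp [List.replicate_succ, ha], hv⟩
    · obtain ⟨v, b, rfl, hv, h2⟩ := exists_of_core h
      exact ⟨0, v, b, by simp [hl], hv, by simpa using h2⟩
    · rw [foldl_dead] at h; exact h.elim

/-- The prefix of length `m` of the paperfolding word. -/
def foldWord (m : ℕ) : List (Fin 7) := (List.range m).map fun i => foldLetter (i + 1)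

theorem foldWord_getElem? {m i : ℕ} (h : i < m) : (foldWord m)[i]? = some (foldLetter (i + 1)) := by
  simp [foldWord, h]

theorem exists_foldWord_of_mem {w : List (Fin 7)} (hw : w ∈ foldLanguage) : ∃ n a b,
    w = List.replicate a 0 ++ (foldWord (2 ^ (n + 1)) ++ List.replicate b 0) := by
  obtain ⟨hacc, hmis⟩ := mem_foldLanguage.1 hw
  obtain ⟨a, v, b, rfl, hv, hlast⟩ := exists_of_pre hacc
  have hm := hmis a _ rfl
  have hnz : ∀ (i : ℕ) (e : Fin 7), (1 :: v)[i]? = some e → e ≠ 0 := by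
    rintro (_ | i) e he
    · simp at he; subst he; decide
    · exact (hv i e (by simpa using he)).ne_zero
  have hp : ∀ (i : ℕ) (e : Fin 7), (1 :: v)[i]? = some e → e = foldLetter (i + 1) := by
    intro i
    induction i using Nat.strong_induction_on with
    | _ i ih =>
      intro e he
      rcases foldLetter_cases (i + 1) (Nat.succ_ne_zero i) with h | ⟨h, h'⟩ | h | ⟨m, hm1, hm0, h⟩
      · obtain rfl : i = 0 := by omega
        rw [foldLetter_one]; simpa using he.symm
      · obtain ⟨j, rfl⟩ : ∃ j, i = j + 1 := ⟨i - 1, by omega⟩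
        have := hv j e (by simpa using he)
        refine AllowedLetter.eq_foldLetter (by omega) (by omega) ?_
        convert this using 1; push_cast; ring
      · obtain ⟨j, rfl⟩ : ∃ j, i = j + 1 := ⟨i - 1, by omega⟩
        have := hv j e (by simpa using he)
        refine AllowedLetter.eq_foldLetter (by omega) (by omega) ?_
        convert this using 1; push_cast; ring
      · obtain ⟨j, rfl⟩ : ∃ j, m = j + 1 := ⟨m - 1, by omega⟩
        obtain rfl : i = 2 * j + 1 := by omega
        obtain ⟨hi, -⟩ := List.getElem?_eq_some_iff.1 he
        have hj : (1 :: v)[j]? = some (1 :: v)[j] := List.getElem?_eq_getElem (by omega)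
        rw [h, foldLetter_two_mul hm0, ← ih j (by omega) _ hj]
        by_contra hne
        refine hm (hasMismatch_iff.2 ⟨j, _, e, ?_, ?_, ?_, hnz _ _ hj, hnz _ _ he, hne⟩)
        · rw [List.getElem?_append_left (by omega), hj]
        · rw [List.getElem?_append_left (by omega), he]
        · rw [List.take_append_of_le_length (by omega)]
          intro h0
          obtain ⟨k, hk⟩ := List.mem_iff_getElem?.1 (List.mem_of_mem_take h0)
          exact hnz _ _ hk rfl
  have hpw : 1 :: v = foldWord (1 :: v).length := by
    refine List.ext_getElem? fun i => ?_
    by_cases hi : i < (1 :: v).length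
    · rw [foldWord_getElem? hi, List.getElem?_eq_getElem hi, hp i _ (List.getElem?_eq_getElem hi)]
    · rw [List.getElem?_eq_none (by omega),
        List.getElem?_eq_none (by simp [foldWord] at hi ⊢; omega)]
  have h2 : foldLetter (v.length + 1) = 2 := by
    have hv0 : v ≠ [] := by rintro rfl; simp at hlast
    refine (hp v.length 2 ?_).symm
    rw [List.getLast?_eq_getElem?] at hlast
    have : 0 < v.length := List.length_pos_iff.2 hv0
    rw [← hlast, ← List.getElem?_cons_succ (a := 1) (l := v), Nat.sub_add_cancel this]
  obtain ⟨n, hn⟩ := eq_two_pow_of_foldLetter (Nat.add_one_ne_zero _) (Or.inr h2)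
  rcases n with _ | n
  · rw [hn, pow_zero, foldLetter_one] at h2; exact absurd h2 (by decide)
  · exact ⟨n, a, b, by rw [← hn, ← List.length_cons (a := 1), ← hpw]⟩

theorem foldl_core_foldLetter (m : ℕ) :
    ((List.range m).map fun i => foldLetter (i + 2)).foldl FoldState.next (.core 2 false) =
      .core (m + 2) (decide (foldLetter (m + 1) = 2)) := by
  induction m with
  | zero => simp [foldLetter_one]
  | succ m ih =>
    have h1 := allowedLetter_foldLetter (k := m + 2) (by omega)
    push_cast at h1
    rw [List.range_succ, List.map_append, List.foldl_append, ih]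
    simp only [List.map_cons, List.map_nil, List.foldl_cons, List.foldl_nil, FoldState.next,
      if_neg h1.ne_zero, if_pos h1]
    congr 1
    push_cast; ring

theorem foldl_replicate_zero {q : FoldState} (h : q.next 0 = q) (b : ℕ) :
    (List.replicate b 0).foldl FoldState.next q = q := by
  induction b with
  | zero => rfl
  | succ b ih => rw [List.replicate_succ, List.foldl_cons, h, ih]

theorem foldWord_mem (n a b : ℕ) :
    List.replicate a 0 ++ (foldWord (2 ^ (n + 1)) ++ List.replicate b 0) ∈ foldLanguage := by
  obtain ⟨m, hm⟩ : ∃ m, 2 ^ (n + 1) = m + 1 :=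
    ⟨2 ^ (n + 1) - 1, by have := Nat.one_le_two_pow (n := n + 1); omega⟩
  have hfw : foldWord (m + 1) = 1 :: (List.range m).map fun i => foldLetter (i + 2) := by
    rw [foldWord, List.range_succ_eq_map, List.map_cons, List.map_map, foldLetter_one]
    rfl
  refine mem_foldLanguage.2 ⟨?_, fun a' w' h hmis => ?_⟩
  · rw [List.foldl_append, foldl_replicate_zero (by simp [FoldState.next]), List.foldl_append, hm,
      hfw, List.foldl_cons]
    have : FoldState.pre.next 1 = .core 2 false := by simp [FoldState.next]
    rw [this, foldl_core_foldLetter, ← hm, foldLetter_two_pow]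
    rcases b with _ | b
    · simp [FoldState.Accepting]
    · rw [List.replicate_succ, List.foldl_cons,
        show (FoldState.core (m + 2) (decide ((2 : Fin 7) = 2))).next 0 = .post by
          simp [FoldState.next], foldl_replicate_zero (by simp [FoldState.next])]
      trivial
  · obtain ⟨i, e, f, he, hf, h0, he0, hf0, hne⟩ := hasMismatch_iff.1 hmis
    have hdrop : ∀ (k : ℕ) (c : Fin 7) (l : List (Fin 7)), c ≠ 0 →
        (List.replicate k 0 ++ c :: l).dropWhile (· == 0) = c :: l := by
      intro k c l hc
      induction k with
      | zero => simp [hc]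
      | succ k ih => simpa [List.replicate_succ] using ih
    have hw' : w' = foldWord (2 ^ (n + 1)) ++ List.replicate b 0 := by
      rcases w' with _ | ⟨c, l⟩
      · simp at he
      have hc : c ≠ 0 := by
        rcases i with _ | i
        · simp at he; rwa [he]
        · rw [List.take_succ_cons, List.mem_cons, not_or] at h0
          exact Ne.symm h0.1
      have := congrArg (List.dropWhile (· == 0)) h
      rw [hdrop _ _ _ hc, hm, hfw, List.cons_append, hdrop _ _ _ (by decide)] at this
      rw [← this, hm, hfw, List.cons_append]
    subst hw'
    have hlen : (foldWord (2 ^ (n + 1))).length = 2 ^ (n + 1) := by simp [foldWord]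
    have hlt : 2 * i + 1 < 2 ^ (n + 1) := by
      by_contra hge
      rw [List.getElem?_append_right (by omega)] at hf
      exact hf0 (List.eq_of_mem_replicate (List.mem_of_getElem? hf))
    rw [List.getElem?_append_left (by omega), foldWord_getElem? (by omega)] at he hf
    cases he; cases hf
    exact hne (foldLetter_two_mul (Nat.succ_ne_zero i))

end Folding

noncomputable section LetterMatrices

/-- The rotations of `ℝ³` that the letters stand for. -/
def letterMat : Fin 7 → Matrix (Fin 3) (Fin 3) ℝ :=
  ![rotZ baseAngle, rotX baseAngle, rotZ baseAngle, rotX baseAngle, rotX (-baseAngle),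
    rotZ baseAngle, rotZ (-baseAngle)]

theorem letterMat_transpose_mul_self (e : Fin 7) : (letterMat e)ᵀ * letterMat e = 1 := by
  fin_cases e <;> simp [letterMat, rotZ_transpose_mul_self, rotX_transpose_mul_self]

theorem exists_letterMat_eq_map (e : Fin 7) :
    ∃ B : Matrix (Fin 3) (Fin 3) ℚ, letterMat e = B.map (Rat.castHom ℝ) := by
  have hz : rotZ baseAngle = (!![4 / 5, -3 / 5, 0; 3 / 5, 4 / 5, 0; 0, 0, 1] :
      Matrix (Fin 3) (Fin 3) ℚ).map (Rat.castHom ℝ) := by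
    ext i j
    fin_cases i <;> fin_cases j <;> simp [rotZ, cos_baseAngle, sin_baseAngle, neg_div]
  have hx : rotX baseAngle = (!![1, 0, 0; 0, 4 / 5, -3 / 5; 0, 3 / 5, 4 / 5] :
      Matrix (Fin 3) (Fin 3) ℚ).map (Rat.castHom ℝ) := by
    ext i j
    fin_cases i <;> fin_cases j <;> simp [rotX, cos_baseAngle, sin_baseAngle, neg_div]
  have hz' : ∃ B : Matrix (Fin 3) (Fin 3) ℚ, rotZ (-baseAngle) = B.map (Rat.castHom ℝ) :=
    ⟨_, by rw [← rotZ_transpose, hz, Matrix.transpose_map]⟩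
  have hx' : ∃ B : Matrix (Fin 3) (Fin 3) ℚ, rotX (-baseAngle) = B.map (Rat.castHom ℝ) :=
    ⟨_, by rw [← rotX_transpose, hx, Matrix.transpose_map]⟩
  fin_cases e
  exacts [⟨_, hz⟩, ⟨_, hx⟩, ⟨_, hz⟩, ⟨_, hx⟩, hx', ⟨_, hz⟩, hz']

theorem InverseLetters.letterMat_mul {e f : Fin 7} (h : InverseLetters e f) :
    letterMat e * letterMat f = 1 := by
  rcases h with ⟨rfl | rfl, rfl⟩ | ⟨rfl, rfl⟩ | ⟨rfl | rfl, rfl⟩ | ⟨rfl, rfl⟩ <;>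
    simp [letterMat, ← rotX_add, ← rotZ_add, rotX_zero, rotZ_zero]

theorem lift_letterMat_transpose_mul_self (u : FreeMonoid (Fin 7)) :
    (FreeMonoid.lift letterMat u)ᵀ * FreeMonoid.lift letterMat u = 1 := by
  induction u using FreeMonoid.inductionOn with
  | one => simp
  | of e => simpa using letterMat_transpose_mul_self e
  | mul u v hu hv =>
    rw [map_mul, Matrix.transpose_mul, Matrix.mul_assoc,
      ← Matrix.mul_assoc (FreeMonoid.lift letterMat u)ᵀ, hu, Matrix.one_mul, hv]

theorem exists_lift_letterMat_eq_map (u : FreeMonoid (Fin 7)) :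
    ∃ B : Matrix (Fin 3) (Fin 3) ℚ, FreeMonoid.lift letterMat u = B.map (Rat.castHom ℝ) := by
  induction u using FreeMonoid.inductionOn with
  | one => exact ⟨1, by simp⟩
  | of e => simpa using exists_letterMat_eq_map e
  | mul u v hu hv =>
    obtain ⟨B, hB⟩ := hu
    obtain ⟨C, hC⟩ := hv
    exact ⟨B * C, by rw [map_mul, hB, hC, Matrix.map_mul]⟩

/-- The product of the rotations along the prefix of length `m` of the paperfolding word. -/
def foldProd (m : ℕ) : Matrix (Fin 3) (Fin 3) ℝ := ((foldWord m).map letterMat).prod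

theorem foldProd_succ (m : ℕ) :
    foldProd (m + 1) = foldProd m * letterMat (foldLetter (m + 1)) := by
  simp [foldProd, foldWord, List.range_succ]

theorem foldProd_two_pow_add {n m : ℕ} (hm : 2 ^ (n + 1) = m + 1) {j k : ℕ} (hjk : j + k = m) :
    foldProd (m + 1 + j) = foldProd m * rotZ baseAngle * (foldProd m)ᵀ * foldProd k := by
  induction j generalizing k with
  | zero =>
    obtain rfl : k = m := by omega
    have ho : (foldProd k)ᵀ * foldProd k = 1 := by
      simpa [FreeMonoid.lift_ofList, foldProd] using
        lift_letterMat_transpose_mul_self (FreeMonoid.ofList (foldWord k))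
    rw [Matrix.mul_assoc _ _ (foldProd k), ho, Matrix.mul_one, add_zero, foldProd_succ, ← hm,
      foldLetter_two_pow]
    rfl
  | succ j ih =>
    have hinv := (inverseLetters_foldLetter (n := n + 2) (a := k + 1) (b := m + 1 + j + 1)
      (by omega) (by omega) (by rw [pow_succ, hm]; omega)).letterMat_mul
    rw [← add_assoc, foldProd_succ, ih (k := k + 1) (by omega), foldProd_succ k]
    simp only [Matrix.mul_assoc, hinv, Matrix.mul_one]

theorem foldProd_eq_conjSeq {n m : ℕ} (hm : 2 ^ (n + 1) = m + 1) : foldProd m = conjSeq n := by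
  induction n generalizing m with
  | zero =>
    obtain rfl : m = 1 := by omega
    simp [foldProd, foldWord, foldLetter_one, letterMat, conjSeq]
  | succ n ih =>
    obtain ⟨m', hm'⟩ : ∃ m', 2 ^ (n + 1) = m' + 1 :=
      ⟨2 ^ (n + 1) - 1, by have := Nat.one_le_two_pow (n := n + 1); omega⟩
    obtain rfl : m = m' + 1 + m' := by rw [pow_succ] at hm; omega
    rw [foldProd_two_pow_add hm' (add_zero m'), ih hm']
    simp [foldProd, foldWord, conjSeq]

theorem lift_letterMat_foldWord (n a b : ℕ) :
    FreeMonoid.lift letterMat (FreeMonoid.ofList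
      (List.replicate a 0 ++ (foldWord (2 ^ (n + 1)) ++ List.replicate b 0))) =
        rotZ baseAngle ^ a * conjSeq n * rotZ baseAngle ^ (b + 1) := by
  obtain ⟨m, hm⟩ : ∃ m, 2 ^ (n + 1) = m + 1 :=
    ⟨2 ^ (n + 1) - 1, by have := Nat.one_le_two_pow (n := n + 1); omega⟩
  have h : ((foldWord (2 ^ (n + 1))).map letterMat).prod = conjSeq n * rotZ baseAngle := by
    change foldProd (2 ^ (n + 1)) = _
    rw [hm, foldProd_succ, ← hm, foldLetter_two_pow, foldProd_eq_conjSeq hm]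
    rfl
  rw [FreeMonoid.lift_ofList, List.map_append, List.map_append, List.prod_append,
    List.prod_append, h, List.map_replicate, List.map_replicate, List.prod_replicate,
    List.prod_replicate, pow_succ']
  simp only [Matrix.mul_assoc]
  rfl

end LetterMatrices

/-- There exist a finite alphabet, a dimension `n`, a monoid morphism `φ` into
the orthogonal `n×n` matrices with rational entries, and a language `L` whose complement is
context-free, such that the closure of `φ(L)` is not semialgebraic. -/
theorem exists_coContextFree_language_closure_not_semialgebraic :
    ∃ (m n : ℕ) (φ : FreeMonoid (Fin m) →* Matrix (Fin n) (Fin n) ℝ)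
      (L : Language (Fin m)),
      (∀ u, (φ u)ᵀ * φ u = 1) ∧
      (∀ u i j, ∃ q : ℚ, φ u i j = (q : ℝ)) ∧
      (Lᶜ).IsContextFree ∧
      ¬ MatSemialgebraic (closure
        ((fun w : List (Fin m) => φ (FreeMonoid.ofList w)) '' L)) := by
  refine ⟨7, 3, FreeMonoid.lift letterMat, foldLanguage, lift_letterMat_transpose_mul_self,
    fun u i j => ?_, ?_, closure_conjSeq_not_matSemialgebraic ?_ fun n a b => ?_⟩
  · obtain ⟨B, hB⟩ := exists_lift_letterMat_eq_map u
    exact ⟨B i j, by rw [hB]; rfl⟩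
  · have h : foldLanguageᶜ = {w | LinearGen FoldStep FoldFinal (.state .pre) w} :=
      compl_compl (α := Set (List (Fin 7))) _
    rw [h]
    exact linearGen_isContextFree _ _ _
  · rintro _ ⟨w, hw, rfl⟩
    obtain ⟨n, a, b, rfl⟩ := exists_foldWord_of_mem hw
    exact ⟨n, a, b + 1, lift_letterMat_foldWord n a b⟩
  · exact ⟨_, foldWord_mem n a b, lift_letterMat_foldWord n a b⟩
end
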